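/- Let G ⊆ S_n be a primitive permutation group with k = ind(G) and n > 1. Then for every ε > 0 there is a constant C_ε such that for all X ≥ 2, the number of subfields K ⊆ ℂ that are number fields of degree n over ℚ with associated Galois group permutation-isomorphic to G and with absolute discriminant |disc(K)| ≤ X is at most C_ε · X^{(n+2)/4 - 1 + 1/k + ε}. -/

import Mathlib

open scoped Classical
open Polynomial

/-- The monic integer polynomial `f(x) = x^n + a_1 x^{n-1} + ... + a_n`, viewed over `ℚ`
(here `a i` is the coefficient `a_{i+1}`, multiplying `x^{n-1-i}`). -/
noncomputable def polyOf (n : ℕ) (a : Fin n → ℤ) : Polynomial ℚ :=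
  X ^ n + ∑ i : Fin n, C ((a i : ℚ)) * X ^ (n - 1 - (i : ℕ))

/-- A bijection `α ≃ β` induces a group homomorphism `Perm α →* Perm β` by conjugation. -/
def permCongrHom {α β : Type*} (e : α ≃ β) : Equiv.Perm α →* Equiv.Perm β where
  toFun := e.permCongr
  map_one' := by ext x; simp
  map_mul' f g := by ext x; simp [Equiv.Perm.mul_apply]

/-- The Galois group of `f` over `ℚ`, realized as a group of permutations of the set of
complex roots of `f` (the image of the Galois action on the roots). -/
noncomputable def galPermGroup (f : Polynomial ℚ) :
    Subgroup (Equiv.Perm (f.rootSet ℂ)) :=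
  haveI : Fact ((f.map (algebraMap ℚ ℂ)).Splits) := ⟨IsAlgClosed.splits _⟩
  (Polynomial.Gal.galActionHom f ℂ).range

/-- `G_f ≅ G` as permutation groups: some bijection between the complex roots of `f`
and `Ω` conjugates the image of the Galois group acting on the roots onto `G`.
(In particular `f` has `card Ω` distinct complex roots.) -/
noncomputable def HasGaloisGroup {Ω : Type*} (G : Subgroup (Equiv.Perm Ω))
    (f : Polynomial ℚ) : Prop :=
  ∃ e : f.rootSet ℂ ≃ Ω, Subgroup.map (permCongrHom e) (galPermGroup f) = G

/-- `N_n(G,H)`: the number of monic integer polynomials of degree `n = card Ω` with all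
coefficients of absolute value at most `H`, having `n` distinct complex roots and
Galois group permutation-isomorphic to `G ≤ Perm Ω`. -/
noncomputable def Ncount {Ω : Type*} [Fintype Ω] (G : Subgroup (Equiv.Perm Ω))
    (H : ℝ) : ℕ :=
  Set.ncard {a : Fin (Fintype.card Ω) → ℤ |
    (∀ i, |(a i : ℝ)| ≤ H) ∧ HasGaloisGroup G (polyOf (Fintype.card Ω) a)}

/-- The index `ind(g)` of a permutation `g` of a finite set `Ω`: `|Ω|` minus the number
of orbits of the cyclic group generated by `g` on `Ω`. -/
noncomputable def permIndex {Ω : Type*} [Fintype Ω] (g : Equiv.Perm Ω) : ℕ :=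
  Fintype.card Ω - Nat.card (MulAction.orbitRel.Quotient (Subgroup.zpowers g) Ω)

/-- The index `ind(G)` of a permutation group `G ≤ Perm Ω`: the minimum of `ind(g)` over
non-identity `g ∈ G`. -/
noncomputable def groupIndex {Ω : Type*} [Fintype Ω] (G : Subgroup (Equiv.Perm Ω)) : ℕ :=
  sInf {k | ∃ g ∈ G, g ≠ 1 ∧ permIndex g = k}

/-- A permutation group `G ≤ Perm Ω` is primitive: it acts transitively on `Ω` and every
block of the action is trivial (i.e. it preserves no nontrivial partition of `Ω`). -/
def IsPrimitivePermGroup {Ω : Type*} (G : Subgroup (Equiv.Perm Ω)) : Prop :=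
  MulAction.IsPretransitive G Ω ∧
    ∀ B : Set Ω, MulAction.IsBlock G B → MulAction.IsTrivialBlock B

/-- The number field `K ⊆ ℂ` has associated Galois group permutation-isomorphic to `G`:
writing `K = ℚ(α)`, the Galois group of the minimal polynomial of `α` over `ℚ` acting on
its complex roots (equivalently, the Galois group of the Galois closure of `K` acting on
the embeddings `K → ℂ`) is permutation-isomorphic to `G`. -/
noncomputable def FieldHasGaloisGroup {Ω : Type*} (G : Subgroup (Equiv.Perm Ω))
    (K : IntermediateField ℚ ℂ) : Prop :=
  ∃ α : ℂ, IntermediateField.adjoin ℚ {α} = K ∧ HasGaloisGroup G (minpoly ℚ α)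

/-- The absolute value of the discriminant of the ring of integers of a number field
`K ⊆ ℂ` (junk value `0` if `K` is infinite-dimensional over `ℚ`). -/
noncomputable def absDisc (K : IntermediateField ℚ ℂ) : ℕ :=
  if h : FiniteDimensional ℚ K then
    letI := h
    letI : NumberField K := ⟨⟩
    (NumberField.discr K).natAbs
  else 0

theorem pow_factorial_eq_zero_of_weighted_power_sums {F ι : Type*} [Field F]
    (d : ℕ) (s : Finset ι) (hs : s.card = d) (e : ι → F)
    (he : ∀ t ⊆ s, t.Nonempty → ∑ i ∈ t, e i ≠ 0) {R : Type*} [CommRing R] [Algebra F R]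
    (r : ι → R) (hr : ∀ m, 1 ≤ m → m ≤ d → ∑ i ∈ s, e i • r i ^ m = 0) :
    ∀ i ∈ s, r i ^ d.factorial = 0 := by
  induction d generalizing s e R with
  | zero =>
    intro i hi
    rw [Finset.card_eq_zero] at hs
    simp [hs] at hi
  | succ d ih =>
    obtain ⟨a, ha⟩ : s.Nonempty := by
      rw [← Finset.card_pos]; omega
    have hq : r a * ∏ j ∈ s.erase a, (r a - r j) = 0 := by
      have key : ∀ q : R[X], q.natDegree ≤ d → ∑ i ∈ s, e i • (r i * q.eval (r i)) = 0 := by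
        intro q hq
        have : ∀ i ∈ s, e i • (r i * q.eval (r i)) =
            ∑ m ∈ Finset.range (d + 1), q.coeff m * (e i • r i ^ (m + 1)) := by
          intro i _
          rw [Polynomial.eval_eq_sum_range' (Nat.lt_succ_of_le hq), Finset.mul_sum,
            Finset.smul_sum]
          refine Finset.sum_congr rfl fun m _ => ?_
          rw [Algebra.smul_def, Algebra.smul_def]
          ring
        rw [Finset.sum_congr rfl this, Finset.sum_comm]
        refine Finset.sum_eq_zero fun m hm => ?_
        rw [← Finset.mul_sum, hr (m + 1) (by omega) (by
          have := Finset.mem_range.mp hm; omega), mul_zero]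
      have h1 := key (∏ j ∈ s.erase a, (X - C (r j))) (by
        refine (Polynomial.natDegree_prod_le _ _).trans ?_
        refine (Finset.sum_le_sum fun j _ => Polynomial.natDegree_X_sub_C_le (r j)).trans ?_
        simp [Finset.card_erase_of_mem ha, hs])
      rw [Finset.sum_eq_single_of_mem a ha] at h1
      · have hea : e a ≠ 0 := by simpa using he {a} (by simpa using ha) (by simp)
        have h2 : (e a)⁻¹ • (e a • (r a * ∏ j ∈ s.erase a, (r a - r j))) = 0 := by
          rw [Polynomial.eval_prod] at h1
          simp only [Polynomial.eval_sub, Polynomial.eval_X, Polynomial.eval_C] at h1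
          rw [h1, smul_zero]
        rwa [smul_smul, inv_mul_cancel₀ hea, one_smul] at h2
      · intro b hb hba
        rw [Polynomial.eval_prod, Finset.prod_eq_zero (i := b) (by simp [hb, hba]) (by simp)]
        simp
    have hfac : (d + 1).factorial = d.factorial + ∑ _j ∈ s.erase a, d.factorial := by
      rw [Finset.sum_const, Finset.card_erase_of_mem ha, hs, Nat.factorial_succ, smul_eq_mul]
      simp; ring
    -- vanishing modulo `r a`
    have hA : ∀ i ∈ s, r a ∣ r i ^ d.factorial := by
      intro i hi
      rcases eq_or_ne i a with rfl | hia
      · exact dvd_pow_self _ (Nat.factorial_ne_zero d)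
      · rw [← Ideal.mem_span_singleton, ← Ideal.Quotient.eq_zero_iff_mem, map_pow]
        refine ih (s.erase a) (by rw [Finset.card_erase_of_mem ha, hs]; rfl) e
          (fun t ht hne => he t (ht.trans (Finset.erase_subset _ _)) hne)
          (fun i => Ideal.Quotient.mk (Ideal.span {r a}) (r i)) ?_ i (by simp [hi, hia])
        intro m hm1 hm2
        have h0 := congrArg (Ideal.Quotient.mk (Ideal.span {r a})) (hr m hm1 (by omega))
        rw [← Finset.add_sum_erase s _ ha, map_add, map_sum, map_zero] at h0
        have hz : Ideal.Quotient.mk (Ideal.span {r a}) (e a • r a ^ m) = 0 := by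
          rw [Ideal.Quotient.eq_zero_iff_mem, Ideal.mem_span_singleton, Algebra.smul_def]
          exact Dvd.dvd.mul_left (dvd_pow_self _ (by omega)) _
        rw [hz, zero_add] at h0
        rw [← h0]
        refine Finset.sum_congr rfl fun i _ => ?_
        rw [← map_pow]
        exact (map_smul (Ideal.Quotient.mkₐ F (Ideal.span {r a})) _ _).symm
    -- vanishing modulo `r a - r j`
    have hB : ∀ j ∈ s.erase a, ∀ i ∈ s, (r a - r j) ∣ r i ^ d.factorial := by
      intro j hj i hi
      have hja : j ≠ a := Finset.ne_of_mem_erase hj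
      have hjs : j ∈ s := Finset.mem_of_mem_erase hj
      set I := Ideal.span {r a - r j} with hI
      have heq : Ideal.Quotient.mk I (r a) = Ideal.Quotient.mk I (r j) := by
        rw [Ideal.Quotient.eq, hI]
        exact Ideal.mem_span_singleton_self _
      have haj : a ∈ s.erase j := by simp [ha, hja.symm]
      have main : ∀ i ∈ s.erase j, (Ideal.Quotient.mk I (r i)) ^ d.factorial = 0 := by
        refine ih (s.erase j) (by rw [Finset.card_erase_of_mem hjs, hs]; rfl)
          (Function.update e a (e a + e j)) ?_ (fun i => Ideal.Quotient.mk I (r i)) ?_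
        · intro t ht hne
          have hjt : j ∉ t := fun h => by simpa using ht h
          by_cases hat : a ∈ t
          · rw [← Finset.add_sum_erase t _ hat, Function.update_self]
            have : ∑ x ∈ t.erase a, Function.update e a (e a + e j) x = ∑ x ∈ t.erase a, e x :=
              Finset.sum_congr rfl fun x hx => by
                rw [Function.update_of_ne (Finset.ne_of_mem_erase hx)]
            rw [this]
            have h3 := he (insert j t) (by
              intro x hx
              rcases Finset.mem_insert.mp hx with rfl | hx
              · exact hjs
              · exact Finset.mem_of_mem_erase (ht hx)) (by simp)
            rw [Finset.sum_insert hjt, ← Finset.add_sum_erase t _ hat] at h3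
            intro h4; apply h3; rw [← h4]; ring
          · have : ∑ x ∈ t, Function.update e a (e a + e j) x = ∑ x ∈ t, e x :=
              Finset.sum_congr rfl fun x hx => by
                rw [Function.update_of_ne]; rintro rfl; exact hat hx
            rw [this]
            exact he t (ht.trans (Finset.erase_subset _ _)) hne
        · intro m hm1 hm2
          have h0 := congrArg (Ideal.Quotient.mkₐ F I) (hr m hm1 (by omega))
          rw [← Finset.add_sum_erase s _ hjs, ← Finset.add_sum_erase (s.erase j) _ haj,
            map_add, map_add, map_sum, map_zero, map_smul, map_smul, map_pow, map_pow] at h0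
          rw [← Finset.add_sum_erase (s.erase j) _ haj, Function.update_self, ← h0]
          have hS : ∑ x ∈ (s.erase j).erase a, Function.update e a (e a + e j) x •
              (Ideal.Quotient.mk I) (r x) ^ m =
              ∑ x ∈ (s.erase j).erase a, (Ideal.Quotient.mkₐ F I) (e x • r x ^ m) :=
            Finset.sum_congr rfl fun x hx => by
              rw [Function.update_of_ne (Finset.ne_of_mem_erase hx), map_smul, map_pow]
              rfl
          rw [hS]
          simp only [Ideal.Quotient.mkₐ_eq_mk]
          rw [heq, add_smul]
          ring
      rw [← Ideal.mem_span_singleton, ← Ideal.Quotient.eq_zero_iff_mem, map_pow]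
      by_cases hij : i = j
      · rw [hij, ← heq]; exact main a haj
      · exact main i (by simp [hi, hij])
    intro i hi
    rw [hfac, pow_add, ← Finset.prod_pow_eq_pow_sum, ← zero_dvd_iff, ← hq]
    exact mul_dvd_mul (hA i hi) (Finset.prod_dvd_prod_of_dvd _ _ fun j hj => hB j hj i hi)

theorem MvPolynomial.homogeneousComponent_mul_of_isHomogeneous {σ F : Type*} [CommRing F]
    {a b : MvPolynomial σ F} {i : ℕ} (hb : b.IsHomogeneous i) (n : ℕ) :
    homogeneousComponent n (a * b) =
      if i ≤ n then homogeneousComponent (n - i) a * b else 0 := by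
  let _ : GradedAlgebra (homogeneousSubmodule σ F) := MvPolynomial.gradedAlgebra
  have := DirectSum.coe_decompose_mul_of_right_mem (𝒜 := homogeneousSubmodule σ F)
    (a := a) (b := b) (i := i) n hb
  rw [← decomposition.decompose'_apply, ← decomposition.decompose'_apply]
  exact this

/-- On the solution set of a weighted power sum system, a fixed power of each coordinate agrees
with a polynomial of smaller degree. -/
theorem exists_totalDegree_lt_of_weighted_power_sums {F : Type*} [Field F] (d : ℕ)
    (e : Fin d → F) (he : ∀ t : Finset (Fin d), t.Nonempty → ∑ i ∈ t, e i ≠ 0)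
    (s : ℕ → F) (i : Fin d) :
    ∃ q : MvPolynomial (Fin d) F, q.totalDegree < d.factorial ∧
      ∀ r : Fin d → F, (∀ m, 1 ≤ m → m ≤ d → ∑ j, e j * r j ^ m = s m) →
        r i ^ d.factorial = MvPolynomial.eval r q := by
  set P : Fin d → MvPolynomial (Fin d) F :=
    fun m => ∑ j, MvPolynomial.C (e j) * MvPolynomial.X j ^ ((m : ℕ) + 1) with hP
  have hPhom : ∀ m, (P m).IsHomogeneous ((m : ℕ) + 1) := fun m =>
    MvPolynomial.IsHomogeneous.sum _ _ _ fun j _ => by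
      have := (MvPolynomial.isHomogeneous_C (Fin d) (e j)).mul
        (MvPolynomial.isHomogeneous_X_pow (R := F) j ((m : ℕ) + 1))
      rwa [zero_add] at this
  set N := d.factorial with hN
  have hmem : (MvPolynomial.X i ^ N : MvPolynomial (Fin d) F) ∈ Ideal.span (Set.range P) := by
    rw [← Ideal.Quotient.eq_zero_iff_mem, map_pow]
    refine pow_factorial_eq_zero_of_weighted_power_sums d Finset.univ (by simp) e
      (fun t _ ht => he t ht)
      (fun j => Ideal.Quotient.mk (Ideal.span (Set.range P)) (MvPolynomial.X j)) ?_ i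
      (Finset.mem_univ i)
    intro m hm1 hm2
    have hPm : Ideal.Quotient.mkₐ F (Ideal.span (Set.range P)) (P ⟨m - 1, by omega⟩) = 0 :=
      Ideal.Quotient.eq_zero_iff_mem.mpr (Ideal.subset_span ⟨_, rfl⟩)
    rw [← hPm, hP]
    simp only [map_sum]
    refine Finset.sum_congr rfl fun j _ => ?_
    rw [← MvPolynomial.smul_eq_C_mul, map_smul, map_pow, Nat.sub_add_cancel hm1]
    rfl
  obtain ⟨c, hc⟩ := (Ideal.mem_span_range_iff_exists_fun).mp hmem
  set A : Fin d → MvPolynomial (Fin d) F := fun m =>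
    if (m : ℕ) + 1 ≤ N then MvPolynomial.homogeneousComponent (N - ((m : ℕ) + 1)) (c m) else 0
    with hA
  have hXN : (MvPolynomial.X i ^ N : MvPolynomial (Fin d) F) = ∑ m, A m * P m := by
    have h1 := congrArg (MvPolynomial.homogeneousComponent N) hc
    rw [MvPolynomial.homogeneousComponent_eq_self (MvPolynomial.isHomogeneous_X_pow i N),
      map_sum] at h1
    rw [← h1]
    refine Finset.sum_congr rfl fun m _ => ?_
    rw [MvPolynomial.homogeneousComponent_mul_of_isHomogeneous (hPhom m), hA]
    simp only
    split_ifs <;> simp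
  have hNpos : 0 < N := Nat.factorial_pos d
  refine ⟨∑ m : Fin d, MvPolynomial.C (s ((m : ℕ) + 1)) * A m, ?_, ?_⟩
  · refine (MvPolynomial.totalDegree_finsetSum _ _).trans_lt ?_
    rw [Finset.sup_lt_iff (by simpa using hNpos)]
    intro m _
    refine (MvPolynomial.totalDegree_mul _ _).trans_lt ?_
    rw [MvPolynomial.totalDegree_C, zero_add, hA]
    simp only
    split_ifs with h
    · refine (MvPolynomial.IsHomogeneous.totalDegree_le
        (MvPolynomial.homogeneousComponent_isHomogeneous _ _)).trans_lt ?_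
      omega
    · simpa using hNpos
  · intro r hr
    have h1 := congrArg (MvPolynomial.eval r) hXN
    rw [map_pow, MvPolynomial.eval_X] at h1
    rw [h1, map_sum, map_sum]
    refine Finset.sum_congr rfl fun m _ => ?_
    rw [map_mul, map_mul, MvPolynomial.eval_C, mul_comm]
    congr 1
    rw [← hr ((m : ℕ) + 1) (by omega) (by omega), hP]
    simp

/-- A weighted power sum system has boundedly many solutions. -/
theorem card_le_of_weighted_power_sums {F : Type*} [Field F] (d : ℕ)
    (e : Fin d → F) (he : ∀ t : Finset (Fin d), t.Nonempty → ∑ i ∈ t, e i ≠ 0)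
    (s : ℕ → F) (T : Finset (Fin d → F))
    (hT : ∀ r ∈ T, ∀ m, 1 ≤ m → m ≤ d → ∑ j, e j * r j ^ m = s m) :
    T.card ≤ d.factorial ^ d := by
  choose q hqdeg hq using exists_totalDegree_lt_of_weighted_power_sums d e he s
  set N := d.factorial with hN
  let E : MvPolynomial (Fin d) F →ₗ[F] (T → F) :=
    LinearMap.pi fun t => (MvPolynomial.aeval (t : Fin d → F)).toLinearMap
  have hE : ∀ p (t : T), E p t = MvPolynomial.eval (t : Fin d → F) p := fun p t => by
    simp [E, MvPolynomial.aeval_eq_eval]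
  let mon : (Fin d → Fin N) → (T → F) := fun u =>
    E (∏ i, MvPolynomial.X i ^ ((u i : Fin N) : ℕ))
  have hspan : ∀ D : ℕ, ∀ p : MvPolynomial (Fin d) F, p.totalDegree < D →
      E p ∈ Submodule.span F (Set.range mon) := by
    intro D
    induction D with
    | zero => intro p hp; omega
    | succ D ih =>
      intro p hp
      rw [p.as_sum, map_sum]
      refine Submodule.sum_mem _ fun u hu => ?_
      have hudeg : u.degree ≤ D := by
        have := MvPolynomial.le_totalDegree hu
        rw [Finsupp.degree_eq_sum]
        rw [Finsupp.sum_fintype _ _ (fun _ => rfl)] at this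
        omega
      rw [show MvPolynomial.monomial u (p.coeff u) =
        p.coeff u • MvPolynomial.monomial u (1 : F) by simp [MvPolynomial.smul_monomial], map_smul]
      refine Submodule.smul_mem _ _ ?_
      by_cases hbig : ∀ i, u i < N
      · refine Submodule.subset_span ⟨fun i => ⟨u i, hbig i⟩, ?_⟩
        simp only [mon]
        congr 1
        rw [MvPolynomial.monomial_eq, map_one, one_mul, Finsupp.prod_fintype _ _ (by simp)]
      · push Not at hbig
        obtain ⟨i, hi⟩ := hbig
        have hsplit : MvPolynomial.monomial u (1 : F) =
            MvPolynomial.monomial (u - Finsupp.single i N) (1 : F) * MvPolynomial.X i ^ N := by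
          rw [MvPolynomial.X_pow_eq_monomial, MvPolynomial.monomial_mul, mul_one,
            tsub_add_cancel_of_le (Finsupp.single_le_iff.mpr hi)]
        have hEq : E (MvPolynomial.monomial u (1 : F)) =
            E (MvPolynomial.monomial (u - Finsupp.single i N) (1 : F) * q i) := by
          funext t
          rw [hE, hE, hsplit, map_mul, map_mul, map_pow, MvPolynomial.eval_X,
            hq i t (hT t t.2)]
        rw [hEq]
        refine ih _ ?_
        refine (MvPolynomial.totalDegree_mul _ _).trans_lt ?_
        have h1 : (MvPolynomial.monomial (u - Finsupp.single i N) (1 : F)).totalDegree + N ≤ D := by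
          rw [MvPolynomial.totalDegree_monomial _ one_ne_zero]
          have h2 : (u - Finsupp.single i N).degree + (Finsupp.single i N).degree = u.degree := by
            rw [← map_add, tsub_add_cancel_of_le (Finsupp.single_le_iff.mpr hi)]
          rw [Finsupp.degree_single] at h2
          rw [Finsupp.sum_fintype _ _ (fun _ => rfl), ← Finsupp.degree_eq_sum]
          omega
        have := hqdeg i
        omega
  have htop : Submodule.span F (Set.range mon) = ⊤ := by
    rw [eq_top_iff]
    intro f _
    rw [pi_eq_sum_univ' f]
    refine Submodule.sum_mem _ fun t _ => Submodule.smul_mem _ _ ?_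
    choose j hj using fun t' : {t' : T // t' ≠ t} => Function.ne_iff.mp
      (fun h : (t'.1 : Fin d → F) = t => t'.2 (Subtype.ext h))
    let p : MvPolynomial (Fin d) F :=
      ∏ t' : {t' : T // t' ≠ t}, (MvPolynomial.X (j t') - MvPolynomial.C ((t'.1 : Fin d → F) (j t')))
    have hpt : MvPolynomial.eval (t : Fin d → F) p ≠ 0 := by
      simp only [p, map_prod, map_sub, MvPolynomial.eval_X, MvPolynomial.eval_C]
      exact Finset.prod_ne_zero_iff.mpr fun t' _ => sub_ne_zero.mpr (hj t').symm
    have : (fun t' => if t = t' then (1 : F) else 0) =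
        (MvPolynomial.eval (t : Fin d → F) p)⁻¹ • E p := by
      funext t'
      rw [Pi.smul_apply, hE]
      split_ifs with h
      · subst h; simp [hpt]
      · have : MvPolynomial.eval (t' : Fin d → F) p = 0 := by
          simp only [p, map_prod, map_sub, MvPolynomial.eval_X, MvPolynomial.eval_C]
          exact Finset.prod_eq_zero (Finset.mem_univ ⟨t', fun h' => h h'.symm⟩) (sub_self _)
        simp [this]
    convert Submodule.smul_mem _ (MvPolynomial.eval (t : Fin d → F) p)⁻¹
      (hspan _ p (Nat.lt_succ_self _)) using 1
    rw [← this]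
    funext t'; simp [Pi.single_apply, eq_comm]
  have h1 := finrank_range_le_card (R := F) mon
  rw [Set.finrank, htop, finrank_top, Module.finrank_fintype_fun_eq_card] at h1
  simpa using h1

/-- Two families whose monic polynomials share their leading coefficients have the same first
power sums. -/
theorem sum_pow_eq_of_coeff_prod_X_sub_C_eq {F : Type*} [Field F] {n d : ℕ} (hd : d ≤ n)
    (x y : Fin n → F)
    (h : ∀ j, 1 ≤ j → j ≤ d → (∏ i, (X - C (x i))).coeff (n - j) =
      (∏ i, (X - C (y i))).coeff (n - j)) :
    ∀ m, 1 ≤ m → m ≤ d → ∑ i, x i ^ m = ∑ i, y i ^ m := by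
  have hco : ∀ z : Fin n → F, ∀ j, j ≤ n → (∏ i, (X - C (z i))).coeff (n - j) =
      (-1) ^ j * MvPolynomial.aeval z (MvPolynomial.esymm (Fin n) F j) := by
    intro z j hj
    rw [MvPolynomial.aeval_esymm_eq_multiset_esymm]
    have := Multiset.prod_X_sub_C_coeff (Finset.univ.val.map z) (k := n - j) (by simp)
    rw [Multiset.map_map] at this
    simp only [Multiset.card_map, Finset.card_val, Finset.card_univ, Fintype.card_fin] at this
    rw [show n - (n - j) = j by omega] at this
    exact this
  have hes : ∀ j, j ≤ d → MvPolynomial.aeval x (MvPolynomial.esymm (Fin n) F j) =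
      MvPolynomial.aeval y (MvPolynomial.esymm (Fin n) F j) := by
    intro j hj
    rcases Nat.eq_zero_or_pos j with rfl | hj0
    · simp
    have h1 := h j hj0 hj
    rw [hco x j (hj.trans hd), hco y j (hj.trans hd)] at h1
    exact mul_left_cancel₀ (pow_ne_zero _ (neg_ne_zero.mpr one_ne_zero)) h1
  have hps : ∀ z : Fin n → F, ∀ m, ∑ i, z i ^ m =
      MvPolynomial.aeval z (MvPolynomial.psum (Fin n) F m) := by
    intro z m
    simp [MvPolynomial.psum]
  intro m
  induction m using Nat.strong_induction_on with
  | _ m ih =>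
    intro hm1 hm2
    rw [hps, hps, MvPolynomial.psum_eq_mul_esymm_sub_sum _ _ m hm1]
    simp only [map_sub, map_mul, map_pow, map_neg, map_one, map_sum, map_natCast]
    rw [hes m hm2]
    congr 1
    refine Finset.sum_congr rfl fun a ha => ?_
    simp only [Finset.mem_filter, Set.mem_Ioo] at ha
    have ha' := Finset.HasAntidiagonal.mem_antidiagonal.mp ha.1
    rw [hes a.1 (by omega), ← hps, ← hps, ih a.2 (by omega) (by omega) (by omega)]

/-- The bound for the number of monic polynomials of degree `n` with few distinct roots and
prescribed leading coefficients. -/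
def rootPatternBound (n : ℕ) : ℕ :=
  ∑ d ∈ Finset.range (n + 1), d ^ n * d.factorial ^ d

theorem card_prod_X_sub_C_le_rootPatternBound {F : Type*} [Field F] {p : ℕ} [CharP F p]
    {n : ℕ} (hpn : n < p) {d : ℕ} (hd : d ≤ n) (c : ℕ → F) (T : Finset F[X])
    (hT : ∀ g ∈ T, ∃ x : Fin n → F, g = ∏ i, (X - C (x i)) ∧
      (Finset.univ.image x).card ≤ d ∧ ∀ j, 1 ≤ j → j ≤ d → g.coeff (n - j) = c j) :
    T.card ≤ rootPatternBound n := by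
  let P : (s : Σ d' : ℕ, (Fin n → Fin d')) → (Fin s.1 → F) → F[X] :=
    fun s r => ∏ i, (X - C (r (s.2 i)))
  let S : Finset (Σ d' : ℕ, (Fin n → Fin d')) :=
    (Finset.range (d + 1)).sigma fun d' => Finset.univ
  let U : (s : Σ d' : ℕ, (Fin n → Fin d')) → Finset F[X] :=
    fun s => T.filter fun g => Function.Surjective s.2 ∧ ∃ r, g = P s r
  have hcover : T ⊆ S.biUnion U := by
    intro g hg
    obtain ⟨x, hgx, hcard, -⟩ := hT g hg
    set I := Finset.univ.image x
    let e := I.equivFin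
    let π : Fin n → Fin I.card := fun i => e ⟨x i, Finset.mem_image_of_mem x (Finset.mem_univ i)⟩
    refine Finset.mem_biUnion.mpr ⟨⟨I.card, π⟩, ?_, ?_⟩
    · simp only [S, Finset.mem_sigma, Finset.mem_range, Finset.mem_univ, and_true]
      omega
    · refine Finset.mem_filter.mpr ⟨hg, ?_, fun j => (e.symm j : F), ?_⟩
      · intro j
        obtain ⟨i, -, hi⟩ := Finset.mem_image.mp (e.symm j).2
        refine ⟨i, ?_⟩
        simp only [π]
        rw [← e.apply_symm_apply j]
        congr 1
        exact Subtype.ext hi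
      · simp [P, π, hgx]
  have hU : ∀ s ∈ S, (U s).card ≤ s.1.factorial ^ s.1 := by
    rintro ⟨d', π⟩ hs
    have hd' : d' ≤ d := by
      simp only [S, Finset.mem_sigma, Finset.mem_range, Finset.mem_univ, and_true] at hs
      omega
    by_cases hπ : Function.Surjective π
    swap
    · simp [U, hπ]
    have hr : ∀ g ∈ U ⟨d', π⟩, ∃ r, g = P ⟨d', π⟩ r := fun g hg => (Finset.mem_filter.mp hg).2.2
    choose! r hr using hr
    rcases (U ⟨d', π⟩).eq_empty_or_nonempty with he | ⟨g₀, hg₀⟩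
    · simp [he]
    have hfib : ∀ (z : Fin d' → F) m, ∑ i, z (π i) ^ m =
        ∑ j, ((Finset.univ.filter fun i => π i = j).card : F) * z j ^ m := by
      intro z m
      rw [← Finset.sum_fiberwise_of_maps_to (g := π) (t := Finset.univ) (by simp)]
      refine Finset.sum_congr rfl fun j _ => ?_
      rw [Finset.sum_congr rfl (g := fun _ => z j ^ m)]
      · simp
      · intro i hi
        rw [(Finset.mem_filter.mp hi).2]
    have hinj : Set.InjOn r (U ⟨d', π⟩) := by
      intro g hg g' hg' h
      rw [hr g hg, hr g' hg', h]
    rw [← Finset.card_image_of_injOn hinj]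
    refine card_le_of_weighted_power_sums d'
      (fun j => ((Finset.univ.filter fun i => π i = j).card : F)) ?_
      (fun m => ∑ i, r g₀ (π i) ^ m) _ ?_
    · intro t ht
      have hsum : ∑ j ∈ t, (Finset.univ.filter fun i => π i = j).card =
          (Finset.univ.filter fun i => π i ∈ t).card := by
        rw [Finset.card_eq_sum_card_fiberwise (f := π) (t := t) (by intro i; simp)]
        refine Finset.sum_congr rfl fun j hj => ?_
        congr 1
        ext i
        simp only [Finset.mem_filter, Finset.mem_univ, true_and]
        constructor
        · rintro rfl; exact ⟨hj, rfl⟩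
        · exact fun h => h.2
      rw [← Nat.cast_sum, hsum]
      intro h0
      rw [CharP.cast_eq_zero_iff F p] at h0
      have hpos : 0 < (Finset.univ.filter fun i => π i ∈ t).card := by
        obtain ⟨j, hj⟩ := ht
        obtain ⟨i, hi⟩ := hπ j
        exact Finset.card_pos.mpr ⟨i, by simp [hi, hj]⟩
      have := Nat.le_of_dvd hpos h0
      have h2 : (Finset.univ.filter fun i => π i ∈ t).card ≤ n := by
        simpa using Finset.card_filter_le (Finset.univ : Finset (Fin n)) (fun i => π i ∈ t)
      omega
    · intro z hz m hm1 hm2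
      obtain ⟨g, hg, rfl⟩ := Finset.mem_image.mp hz
      rw [← hfib]
      refine sum_pow_eq_of_coeff_prod_X_sub_C_eq hd (fun i => r g (π i)) (fun i => r g₀ (π i)) ?_
        m hm1 (hm2.trans hd')
      intro j hj1 hj2
      have h1 : ∏ i, (X - C (r g (π i))) = g := (hr g hg).symm
      have h2 : ∏ i, (X - C (r g₀ (π i))) = g₀ := (hr g₀ hg₀).symm
      obtain ⟨-, -, -, h3⟩ := hT g (Finset.mem_filter.mp hg).1
      obtain ⟨-, -, -, h4⟩ := hT g₀ (Finset.mem_filter.mp hg₀).1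
      rw [h1, h2, h3 j hj1 hj2, h4 j hj1 hj2]
  calc T.card ≤ (S.biUnion U).card := Finset.card_le_card hcover
    _ ≤ ∑ s ∈ S, (U s).card := Finset.card_biUnion_le
    _ ≤ ∑ s ∈ S, s.1.factorial ^ s.1 := Finset.sum_le_sum hU
    _ = ∑ d' ∈ Finset.range (d + 1), d' ^ n * d'.factorial ^ d' := by
        rw [Finset.sum_sigma]
        simp
    _ ≤ rootPatternBound n := by
        refine Finset.sum_le_sum_of_subset ?_
        intro i hi
        simp only [Finset.mem_range] at *
        omega

/-- A finite set injecting into tuples, each of whose coordinates takes boundedly many values once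
the previous ones are fixed. -/
theorem card_le_prod_of_prefix_card_le {ι α : Type*} (T : Finset ι) (coord : ℕ → ι → α) (n : ℕ)
    (B : ℕ → ℝ) (hB : ∀ i, 0 ≤ B i)
    (h : ∀ i < n, ∀ t₀ ∈ T,
      (((T.filter fun t => ∀ j < i, coord j t = coord j t₀).image (coord i)).card : ℝ) ≤ B i)
    (hinj : ∀ t ∈ T, ∀ t' ∈ T, (∀ j < n, coord j t = coord j t') → t = t') :
    (T.card : ℝ) ≤ ∏ i ∈ Finset.range n, B i := by
  have key : ∀ m ≤ n, ((T.image fun t => fun j : Fin m => coord j t).card : ℝ) ≤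
      ∏ i ∈ Finset.range m, B i := by
    intro m
    induction m with
    | zero =>
      intro _
      simp only [Finset.range_zero, Finset.prod_empty, Nat.cast_le_one]
      exact Finset.card_le_one_of_subsingleton _
    | succ m ih =>
      intro hm
      set A := T.image fun t => fun j : Fin (m + 1) => coord j t
      let ρ : (Fin (m + 1) → α) → (Fin m → α) := fun u j => u j.castSucc
      have hAρ : A.image ρ = T.image fun t => fun j : Fin m => coord j t := by
        rw [Finset.image_image]; rfl
      have hfib : ∀ b ∈ A.image ρ, (A.filter fun u => ρ u = b).card ≤ ⌊B m⌋₊ := by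
        intro b hb
        rw [hAρ] at hb
        obtain ⟨t₀, ht₀, rfl⟩ := Finset.mem_image.mp hb
        refine Nat.le_floor ((Nat.cast_le.mpr ?_).trans (h m (by omega) t₀ ht₀))
        refine Finset.card_le_card_of_injOn (fun u => u (Fin.last m)) ?_ ?_
        · intro u hu
          simp only [Finset.coe_filter, Set.mem_ofPred_eq] at hu
          obtain ⟨t, ht, rfl⟩ := Finset.mem_image.mp hu.1
          refine Finset.mem_coe.mpr (Finset.mem_image.mpr ⟨t, ?_, rfl⟩)
          refine Finset.mem_filter.mpr ⟨ht, fun j hj => ?_⟩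
          exact congrFun hu.2 ⟨j, hj⟩
        · intro u hu u' hu' heq
          simp only [Finset.coe_filter, Set.mem_ofPred_eq] at hu hu'
          funext j
          refine Fin.lastCases heq (fun j => ?_) j
          exact (congrFun hu.2 j).trans (congrFun hu'.2 j).symm
      have h1 := Finset.card_le_mul_card_image A (f := ρ) ⌊B m⌋₊ hfib
      rw [hAρ] at h1
      rw [Finset.prod_range_succ, mul_comm]
      calc (A.card : ℝ) ≤ ((⌊B m⌋₊ * (T.image fun t => fun j : Fin m => coord j t).card : ℕ) : ℝ) :=
            Nat.cast_le.mpr h1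
        _ = (⌊B m⌋₊ : ℝ) * ((T.image fun t => fun j : Fin m => coord j t).card : ℝ) := by
            push_cast; rfl
        _ ≤ B m * ∏ i ∈ Finset.range m, B i :=
            mul_le_mul (Nat.floor_le (hB m)) (ih (by omega)) (by positivity) (hB m)
  have := key n le_rfl
  rwa [Finset.card_image_of_injOn] at this
  intro t ht t' ht' heq
  exact hinj t ht t' ht' fun j hj => congrFun heq ⟨j, hj⟩

theorem card_le_of_abs_le_of_modEq (A : Finset ℤ) {B : ℝ} (hB : 0 ≤ B) {c : ℕ} (hc : 0 < c)
    (hA : ∀ a ∈ A, |(a : ℝ)| ≤ B) (hmod : ∀ a ∈ A, ∀ b ∈ A, a ≡ b [ZMOD c]) :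
    (A.card : ℝ) ≤ 2 * B / c + 1 := by
  rcases A.eq_empty_or_nonempty with rfl | hne
  · simp; positivity
  set m := A.min' hne
  have hm : m ∈ A := A.min'_mem hne
  have hc' : (0 : ℝ) < c := by exact_mod_cast hc
  have key : A.card ≤ (Finset.range (⌊2 * B / c⌋₊ + 1)).card := by
    refine Finset.card_le_card_of_injOn (fun a => ((a - m) / c).toNat) ?_ ?_
    · intro a ha
      simp only [Finset.coe_range, Set.mem_Iio, Nat.lt_succ_iff]
      refine Nat.le_floor ?_
      rw [le_div_iff₀ hc']
      obtain ⟨q, hq⟩ := (hmod m hm a ha).dvd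
      have h0 : m ≤ a := A.min'_le a ha
      have hcz : (0 : ℤ) < c := by exact_mod_cast hc
      have hq0 : 0 ≤ q := by
        by_contra! hneg
        nlinarith
      have hdiv : (a - m) / c = q := by
        rw [hq, Int.mul_ediv_cancel_left _ hcz.ne']
      simp only [hdiv]
      have h1 : ((q.toNat : ℕ) : ℝ) = (q : ℝ) := by
        exact_mod_cast congrArg (Int.cast : ℤ → ℝ) (Int.toNat_of_nonneg hq0)
      rw [h1]
      have h2 : (a : ℝ) - m = c * q := by exact_mod_cast hq
      have h3 := abs_le.mp (hA a ha)
      have h4 := abs_le.mp (hA m hm)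
      nlinarith [h3.2, h4.1]
    · intro a ha b hb hab
      obtain ⟨q, hq⟩ := (hmod m hm a ha).dvd
      obtain ⟨r, hr⟩ := (hmod m hm b hb).dvd
      have h0 : m ≤ a := A.min'_le a ha
      have h0' : m ≤ b := A.min'_le b hb
      have hcz : (0 : ℤ) < c := by exact_mod_cast hc
      have h1 : (a - m) / c = q := by rw [hq, Int.mul_ediv_cancel_left _ hcz.ne']
      have h2 : (b - m) / c = r := by rw [hr, Int.mul_ediv_cancel_left _ hcz.ne']
      have hq0 : 0 ≤ q := by by_contra! hneg; nlinarith
      have hr0 : 0 ≤ r := by by_contra! hneg; nlinarith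
      simp only [h1, h2] at hab
      have : q = r := by omega
      subst this
      omega
  rw [Finset.card_range] at key
  calc (A.card : ℝ) ≤ ((⌊2 * B / c⌋₊ + 1 : ℕ) : ℝ) := Nat.cast_le.mpr key
    _ ≤ 2 * B / c + 1 := by
      push_cast
      have := Nat.floor_le (a := 2 * B / c) (by positivity)
      linarith

/-- Integers in an interval restricted to few residue classes modulo several primes. -/
theorem card_le_of_card_image_zmod_le (A : Finset ℤ) {B : ℝ} (hB : 0 ≤ B) (S : Finset ℕ)
    (hS : ∀ p ∈ S, p.Prime) (hA : ∀ a ∈ A, |(a : ℝ)| ≤ B) (M : ℕ)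
    (hM : ∀ p ∈ S, (A.image (Int.cast : ℤ → ZMod p)).card ≤ M) :
    (A.card : ℝ) ≤ M ^ S.card * (2 * B / (∏ p ∈ S, p : ℕ) + 1) := by
  let Φ : ℤ → ((p : ℕ) → p ∈ S → ZMod p) := fun a p _ => a
  have hfib : ∀ b ∈ A.image Φ, (A.filter fun a => Φ a = b).card ≤
      ⌊2 * B / (∏ p ∈ S, p : ℕ) + 1⌋₊ := by
    intro b _
    refine Nat.le_floor (card_le_of_abs_le_of_modEq _ hB
      (Finset.prod_pos fun p hp => (hS p hp).pos)
      (fun a ha => hA a (Finset.mem_filter.mp ha).1) ?_)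
    intro a ha a' ha'
    have h : Φ a = Φ a' := (Finset.mem_filter.mp ha).2.trans (Finset.mem_filter.mp ha').2.symm
    have h1 : ∀ p ∈ S, (p : ℤ) ∣ a' - a := fun p hp => by
      have h2 : (a : ZMod p) = a' := congrFun (congrFun h p) hp
      exact ((ZMod.intCast_eq_intCast_iff _ _ _).mp h2).dvd
    refine (Int.modEq_iff_dvd).mpr ?_
    push_cast
    refine Finset.prod_dvd_of_coprime ?_ h1
    intro p hp q hq hpq
    exact (Nat.isCoprime_iff_coprime.mpr
      ((Nat.coprime_primes (hS p hp) (hS q hq)).mpr hpq))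
  have himg : (A.image Φ).card ≤ M ^ S.card := by
    calc (A.image Φ).card ≤ (S.pi fun p => A.image (Int.cast : ℤ → ZMod p)).card := by
          refine Finset.card_le_card ?_
          intro b hb
          obtain ⟨a, ha, rfl⟩ := Finset.mem_image.mp hb
          exact Finset.mem_pi.mpr fun p hp => Finset.mem_image_of_mem _ ha
      _ = ∏ p ∈ S, (A.image (Int.cast : ℤ → ZMod p)).card := Finset.card_pi _ _
      _ ≤ ∏ _p ∈ S, M := Finset.prod_le_prod' hM
      _ = M ^ S.card := by simp
  have h1 := Finset.card_le_mul_card_image A (f := Φ) _ hfib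
  have h0 : 0 ≤ 2 * B / (∏ p ∈ S, p : ℕ) + 1 := by positivity
  calc (A.card : ℝ) ≤ (⌊2 * B / (∏ p ∈ S, p : ℕ) + 1⌋₊ : ℝ) * ((A.image Φ).card : ℝ) := by
        exact_mod_cast h1
    _ ≤ (2 * B / (∏ p ∈ S, p : ℕ) + 1) * (M ^ S.card : ℝ) := by
        refine mul_le_mul (Nat.floor_le h0) (by exact_mod_cast himg) (by positivity) h0
    _ = _ := mul_comm _ _

theorem exists_pow_card_primeFactors_le (M : ℕ) (hM : 1 ≤ M) {ε : ℝ} (hε : 0 < ε) :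
    ∃ K : ℝ, 1 ≤ K ∧ ∀ D : ℕ, 0 < D → (M : ℝ) ^ D.primeFactors.card ≤ K * (D : ℝ) ^ ε := by
  have hM' : (1 : ℝ) ≤ M := by exact_mod_cast hM
  set P := ⌈(M : ℝ) ^ (1 / ε)⌉₊
  refine ⟨(M : ℝ) ^ P, one_le_pow₀ hM', fun D hD => ?_⟩
  have hsplit := Finset.card_filter_add_card_filter_not (s := D.primeFactors) (fun p => p < P)
  rw [← hsplit, pow_add]
  refine mul_le_mul ?_ ?_ (by positivity) (by positivity)
  · refine pow_le_pow_right₀ hM' ?_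
    calc (D.primeFactors.filter fun p => p < P).card ≤ (Finset.range P).card := by
          refine Finset.card_le_card fun p hp => ?_
          simpa using (Finset.mem_filter.mp hp).2
      _ = P := Finset.card_range P
  · calc (M : ℝ) ^ (D.primeFactors.filter fun p => ¬ p < P).card
        = ∏ _p ∈ D.primeFactors.filter fun p => ¬ p < P, (M : ℝ) := by simp
      _ ≤ ∏ p ∈ D.primeFactors.filter fun p => ¬ p < P, (p : ℝ) ^ ε := by
          refine Finset.prod_le_prod (fun _ _ => by positivity) fun p hp => ?_
          have hp' : P ≤ p := not_lt.mp (Finset.mem_filter.mp hp).2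
          have h1 : (M : ℝ) ^ (1 / ε) ≤ p := (Nat.le_ceil _).trans (by exact_mod_cast hp')
          calc (M : ℝ) = ((M : ℝ) ^ (1 / ε)) ^ ε := by
                rw [← Real.rpow_mul (by positivity), one_div_mul_cancel hε.ne', Real.rpow_one]
            _ ≤ (p : ℝ) ^ ε := Real.rpow_le_rpow (by positivity) h1 hε.le
      _ = ((∏ p ∈ D.primeFactors.filter fun p => ¬ p < P, p : ℕ) : ℝ) ^ ε := by
          rw [Nat.cast_prod, Real.finsetProd_rpow _ _ fun _ _ => by positivity]
      _ ≤ (D : ℝ) ^ ε := by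
          refine Real.rpow_le_rpow (by positivity) ?_ hε.le
          have h1 : (∏ p ∈ D.primeFactors.filter fun p => ¬ p < P, p) ∣ D :=
            (Finset.prod_dvd_prod_of_subset _ _ _ (Finset.filter_subset _ _)).trans
              (Nat.prod_primeFactors_dvd D)
          exact_mod_cast Nat.le_of_dvd hD h1

/-- Counting integers all of whose prime exponents lie between `k` and `E`. -/
theorem exists_card_le_of_factorization_bounds (k E : ℕ) (hk : 1 ≤ k) {ε : ℝ} (hε : 0 < ε) :
    ∃ K : ℝ, 1 ≤ K ∧ ∀ X : ℝ, 1 ≤ X → ∀ A : Finset ℕ,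
      (∀ D ∈ A, 0 < D ∧ (D : ℝ) ≤ X ∧
        ∀ p ∈ D.primeFactors, k ≤ D.factorization p ∧ D.factorization p ≤ E) →
      (A.card : ℝ) ≤ K * X ^ (1 / (k : ℝ) + ε) := by
  obtain ⟨K, hK1, hK⟩ := exists_pow_card_primeFactors_le (E + 1) (by omega) hε
  refine ⟨K, hK1, fun X hX A hA => ?_⟩
  have hk' : (1 : ℝ) ≤ k := by exact_mod_cast hk
  have hX0 : 0 < X := by linarith
  let rad : ℕ → ℕ := fun D => ∏ p ∈ D.primeFactors, p
  have hradpos : ∀ D, 0 < rad D := fun D =>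
    Finset.prod_pos fun p hp => (Nat.prime_of_mem_primeFactors hp).pos
  have hrad : ∀ D ∈ A, (rad D : ℝ) ≤ X ^ (1 / (k : ℝ)) := by
    intro D hD
    obtain ⟨h0, hDX, hexp⟩ := hA D hD
    have h1 : rad D ^ k ∣ D := by
      conv_rhs => rw [← Nat.prod_factorization_pow_eq_self h0.ne']
      rw [← Finset.prod_pow, Finsupp.prod, Nat.support_factorization]
      exact Finset.prod_dvd_prod_of_dvd _ _ fun p hp => pow_dvd_pow _ (hexp p hp).1
    have h2 : (rad D : ℝ) ^ k ≤ X := le_trans (by exact_mod_cast Nat.le_of_dvd h0 h1) hDX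
    calc (rad D : ℝ) = ((rad D : ℝ) ^ k) ^ (1 / (k : ℝ)) := by
          rw [← Real.rpow_natCast, ← Real.rpow_mul (by positivity),
            mul_one_div_cancel (by linarith), Real.rpow_one]
      _ ≤ X ^ (1 / (k : ℝ)) := Real.rpow_le_rpow (by positivity) h2 (by positivity)
  have hradX : ∀ D ∈ A, (rad D : ℝ) ≤ X := fun D hD => (hrad D hD).trans <| by
    conv_rhs => rw [← Real.rpow_one X]
    refine Real.rpow_le_rpow_of_exponent_le hX ?_
    rw [div_le_one (by linarith)]
    exact hk'
  have hfib : ∀ r ∈ A.image rad, (A.filter fun D => rad D = r).card ≤ ⌊K * X ^ ε⌋₊ := by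
    intro r hr
    obtain ⟨D₀, hD₀, rfl⟩ := Finset.mem_image.mp hr
    have hpf : ∀ D, (rad D).primeFactors = D.primeFactors := fun D => by
      exact Nat.primeFactors_prod fun p hp => Nat.prime_of_mem_primeFactors hp
    refine Nat.le_floor ?_
    have h1 : (A.filter fun D => rad D = rad D₀).card ≤
        (D₀.primeFactors.pi fun _ => Finset.range (E + 1)).card := by
      refine Finset.card_le_card_of_injOn (fun D p _ => D.factorization p) ?_ ?_
      · intro D hD
        simp only [Finset.coe_filter, Set.mem_ofPred_eq] at hD
        refine Finset.mem_coe.mpr (Finset.mem_pi.mpr fun p hp => ?_)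
        have : p ∈ D.primeFactors := by rwa [← hpf, hD.2, hpf]
        exact Finset.mem_range.mpr (Nat.lt_succ_of_le ((hA D hD.1).2.2 p this).2)
      · intro D hD D' hD' heq
        simp only [Finset.coe_filter, Set.mem_ofPred_eq] at hD hD'
        refine Nat.eq_of_factorization_eq (hA D hD.1).1.ne' (hA D' hD'.1).1.ne' fun p => ?_
        by_cases hp : p ∈ D₀.primeFactors
        · exact congrFun (congrFun heq p) hp
        · have hD1 : p ∉ D.primeFactors := by rwa [← hpf, hD.2, hpf]
          have hD2 : p ∉ D'.primeFactors := by rwa [← hpf, hD'.2, hpf]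
          rw [← Nat.support_factorization, Finsupp.notMem_support_iff] at hD1 hD2
          rw [hD1, hD2]
    rw [Finset.card_pi, Finset.prod_const, Finset.card_range] at h1
    calc ((A.filter fun D => rad D = rad D₀).card : ℝ)
        ≤ (((E + 1 : ℕ) : ℝ)) ^ (rad D₀).primeFactors.card := by
          rw [hpf]; exact_mod_cast h1
      _ ≤ K * (rad D₀ : ℝ) ^ ε := hK _ (hradpos _)
      _ ≤ K * X ^ ε := by
          refine mul_le_mul_of_nonneg_left ?_ (by linarith)
          exact Real.rpow_le_rpow (by positivity) (hradX D₀ hD₀) hε.le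
  have himg : ((A.image rad).card : ℝ) ≤ X ^ (1 / (k : ℝ)) := by
    have h1 : (A.image rad).card ≤ (Finset.Icc 1 ⌊X ^ (1 / (k : ℝ))⌋₊).card := by
      refine Finset.card_le_card fun r hr => ?_
      obtain ⟨D, hD, rfl⟩ := Finset.mem_image.mp hr
      exact Finset.mem_Icc.mpr ⟨hradpos D, Nat.le_floor (hrad D hD)⟩
    rw [Nat.card_Icc, Nat.add_sub_cancel] at h1
    exact (Nat.cast_le.mpr h1).trans (Nat.floor_le (by positivity))
  have h1 := Finset.card_le_mul_card_image A (f := rad) _ hfib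
  have hKX : 0 ≤ K * X ^ ε := by positivity
  calc (A.card : ℝ) ≤ (⌊K * X ^ ε⌋₊ : ℝ) * ((A.image rad).card : ℝ) := by exact_mod_cast h1
    _ ≤ (K * X ^ ε) * X ^ (1 / (k : ℝ)) :=
        mul_le_mul (Nat.floor_le hKX) himg (by positivity) hKX
    _ = K * X ^ (1 / (k : ℝ) + ε) := by rw [Real.rpow_add hX0]; ring

theorem prod_pow_range_eq_rpow {n : ℕ} (hn : 2 ≤ n) {D Y : ℝ} (hD : 1 ≤ D)
    (hY : Y = D ^ (1 / (2 * ((n : ℝ) - 1)))) :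
    ∏ i ∈ Finset.Icc 2 n, Y ^ i = D ^ (((n : ℝ) + 2) / 4) := by
  have hsum : ∀ n : ℕ, 2 ≤ n → ((∑ i ∈ Finset.Icc 2 n, i : ℕ) : ℝ) =
      ((n : ℝ) - 1) * (n + 2) / 2 := by
    intro n hn
    induction n, hn using Nat.le_induction with
    | base => norm_num
    | succ m hm ih =>
      rw [Finset.sum_Icc_succ_top (by omega), Nat.cast_add, ih]
      push_cast; ring
  have hn' : (2 : ℝ) ≤ n := by exact_mod_cast hn
  rw [Finset.prod_pow_eq_pow_sum, hY, ← Real.rpow_natCast, ← Real.rpow_mul (by linarith),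
    hsum n hn]
  congr 1
  have : (n : ℝ) - 1 ≠ 0 := by linarith
  field_simp
  ring

theorem card_le_prod_of_coeff_prefix_card_le {n : ℕ} (T : Finset ℤ[X])
    (hT : ∀ f ∈ T, f.Monic ∧ f.natDegree = n ∧ f.coeff (n - 1) = 0) (B : ℕ → ℝ)
    (hB : ∀ i, 0 ≤ B i)
    (h : ∀ i, 2 ≤ i → i ≤ n → ∀ f₀ ∈ T,
      (((T.filter fun f => ∀ j < i, f.coeff (n - j) = f₀.coeff (n - j)).image
        fun f => f.coeff (n - i)).card : ℝ) ≤ B i) :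
    (T.card : ℝ) ≤ ∏ i ∈ Finset.Icc 2 n, B i := by
  have key := card_le_prod_of_prefix_card_le T (fun i f => f.coeff (n - i)) (n + 1)
    (fun i => if 2 ≤ i then B i else 1) (fun i => by split_ifs; exacts [hB i, zero_le_one]) ?_ ?_
  · refine key.trans_eq ?_
    rw [← Finset.prod_filter]
    congr 1
    ext i
    simp only [Finset.mem_filter, Finset.mem_range, Finset.mem_Icc]
    omega
  · intro i hi f₀ hf₀
    split_ifs with h2
    · convert h i h2 (by omega) f₀ hf₀
    · refine Nat.cast_le_one.mpr (Finset.card_le_one.mpr ?_)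
      have hval : ∀ f ∈ T, f.coeff (n - i) = if i = 0 then 1 else 0 := by
        intro f hf
        obtain ⟨h1, h3, h4⟩ := hT f hf
        have hi' : i = 0 ∨ i = 1 := by omega
        rcases hi' with rfl | rfl
        · have := h1.coeff_natDegree
          simpa [h3] using this
        · simpa using h4
      intro a ha b hb
      simp only [Finset.mem_image, Finset.mem_filter] at ha hb
      obtain ⟨f, hf, rfl⟩ := ha
      obtain ⟨g, hg, rfl⟩ := hb
      rw [hval f hf.1, hval g hg.1]
  · intro f hf g hg hfg
    ext m
    by_cases hm : m ≤ n
    · have := hfg (n - m) (by omega)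
      rwa [show n - (n - m) = m by omega] at this
    · rw [coeff_eq_zero_of_natDegree_lt (by rw [(hT f hf).2.1]; omega),
        coeff_eq_zero_of_natDegree_lt (by rw [(hT g hg).2.1]; omega)]

/-- Monic integer polynomials without second term in a box with sides growing geometrically. -/
theorem card_le_of_coeff_bounds {n : ℕ} (hn : 2 ≤ n) {D Y c : ℝ} (hD : 1 ≤ D) (hc : 1 ≤ c)
    (hY : Y = D ^ (1 / (2 * ((n : ℝ) - 1)))) (T : Finset ℤ[X])
    (hT : ∀ f ∈ T, f.Monic ∧ f.natDegree = n ∧ f.coeff (n - 1) = 0 ∧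
      ∀ i ≤ n, |(f.coeff (n - i) : ℝ)| ≤ c * Y ^ i) :
    (T.card : ℝ) ≤ (3 * c) ^ n * D ^ (((n : ℝ) + 2) / 4) := by
  have hY1 : 1 ≤ Y := by
    rw [hY]
    have hn' : (2 : ℝ) ≤ n := by exact_mod_cast hn
    exact Real.one_le_rpow hD (by apply div_nonneg <;> linarith)
  have key := card_le_prod_of_coeff_prefix_card_le T
    (fun f hf => ⟨(hT f hf).1, (hT f hf).2.1, (hT f hf).2.2.1⟩) (fun i => 3 * c * Y ^ i)
    (fun i => by positivity) ?_
  · refine key.trans ?_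
    rw [Finset.prod_mul_distrib, prod_pow_range_eq_rpow hn hD hY, Finset.prod_const, Nat.card_Icc]
    refine mul_le_mul_of_nonneg_right ?_ (by positivity)
    exact pow_le_pow_right₀ (by linarith) (by omega)
  · intro i hi2 hin f₀ hf₀
    have hB : (1 : ℝ) ≤ c * Y ^ i := one_le_mul_of_one_le_of_one_le hc (one_le_pow₀ hY1)
    have h1 := card_le_of_abs_le_of_modEq ((T.filter fun f => ∀ j < i, f.coeff (n - j) =
        f₀.coeff (n - j)).image fun f => f.coeff (n - i)) (B := c * Y ^ i) (by linarith)
        (c := 1) one_pos ?_ (fun a _ b _ => by simpa using Int.modEq_one)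
    · refine h1.trans ?_
      push_cast
      linarith
    · intro a ha
      obtain ⟨f, hf, rfl⟩ := Finset.mem_image.mp ha
      exact (hT f (Finset.mem_filter.mp hf).1).2.2.2 i hin

/-- Monic integer polynomials without second term in a box, with few distinct roots modulo the
primes dividing `D`. -/
theorem exists_card_le_of_few_roots_mod_primes {n : ℕ} (hn : 2 ≤ n) {k : ℕ} (hk : 2 ≤ k) (E : ℕ)
    {c : ℝ} (hc : 1 ≤ c) {ε : ℝ} (hε : 0 < ε) :
    ∃ K : ℝ, 1 ≤ K ∧ ∀ D : ℕ, 0 < D →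
      (∀ p ∈ D.primeFactors, k ≤ D.factorization p ∧ D.factorization p ≤ E) →
      ∀ T : Finset ℤ[X],
      (∀ f ∈ T, f.Monic ∧ f.natDegree = n ∧ f.coeff (n - 1) = 0 ∧
        ∀ i ≤ n, |(f.coeff (n - i) : ℝ)| ≤ c * ((D : ℝ) ^ (1 / (2 * ((n : ℝ) - 1)))) ^ i) →
      (∀ p ∈ D.primeFactors, n < p → ∃ (F : Type) (_ : Field F) (_ : CharP F p), ∀ f ∈ T,
        ∃ x : Fin n → F, f.map (Int.castRingHom F) = ∏ i, (X - C (x i)) ∧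
          (Finset.univ.image x).card + D.factorization p ≤ n) →
      (T.card : ℝ) ≤ K * (D : ℝ) ^ (((n : ℝ) + 2) / 4 - 1 + ε) := by
  set M := rootPatternBound n with hMdef
  have hM1 : 1 ≤ M := by
    rw [hMdef, rootPatternBound]
    refine le_trans ?_ (Finset.single_le_sum (f := fun d => d ^ n * d.factorial ^ d)
      (fun _ _ => Nat.zero_le _) (Finset.mem_range.mpr (show 1 < n + 1 by omega)))
    simp
  have hM1' : (1 : ℝ) ≤ M := by exact_mod_cast hM1
  obtain ⟨K, hK1, hK⟩ := exists_pow_card_primeFactors_le (M ^ n) (Nat.one_le_pow _ _ hM1) hε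
  refine ⟨K * (3 * c) ^ n * (n : ℝ) ^ (n * E), ?_, ?_⟩
  · refine one_le_mul_of_one_le_of_one_le (one_le_mul_of_one_le_of_one_le hK1
      (one_le_pow₀ (by linarith))) (one_le_pow₀ ?_)
    exact_mod_cast (by omega : 1 ≤ n)
  intro D hD hexp T hT hroots
  rcases T.eq_empty_or_nonempty with rfl | ⟨f₁, hf₁⟩
  · simp; positivity
  have hD1 : (1 : ℝ) ≤ D := by exact_mod_cast hD
  set Y : ℝ := (D : ℝ) ^ (1 / (2 * ((n : ℝ) - 1))) with hY
  have hn' : (2 : ℝ) ≤ n := by exact_mod_cast hn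
  have hY1 : 1 ≤ Y := Real.one_le_rpow hD1 (by apply div_nonneg <;> linarith)
  have hYD : Y ^ (2 * (n - 1)) = D := by
    rw [hY, ← Real.rpow_natCast, ← Real.rpow_mul (by linarith)]
    push_cast [Nat.cast_sub (show 1 ≤ n by omega)]
    rw [one_div_mul_cancel (by linarith : (2 * ((n : ℝ) - 1)) ≠ 0), Real.rpow_one]
  set S := D.primeFactors.filter fun p => n < p with hS
  have hSprime : ∀ p ∈ S, p.Prime := fun p hp =>
    Nat.prime_of_mem_primeFactors (Finset.mem_filter.mp hp).1
  have hvn : ∀ p ∈ S, D.factorization p + 1 ≤ n := by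
    intro p hp
    obtain ⟨F, _, _, hF⟩ := hroots p (Finset.mem_filter.mp hp).1 (Finset.mem_filter.mp hp).2
    obtain ⟨x, -, hx⟩ := hF f₁ hf₁
    have : 0 < (Finset.univ.image x).card :=
      Finset.card_pos.mpr ⟨x ⟨0, by omega⟩, Finset.mem_image_of_mem _ (Finset.mem_univ _)⟩
    omega
  let Si : ℕ → Finset ℕ := fun i => S.filter fun p => n + 1 ≤ D.factorization p + i
  let q : ℕ → ℕ := fun i => ∏ p ∈ Si i, p
  have hqpos : ∀ i, 0 < q i := fun i =>
    Finset.prod_pos fun p hp => (hSprime p (Finset.mem_filter.mp hp).1).pos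
  have hq : ∀ i, 2 ≤ i → i ≤ n → (q i : ℝ) ≤ Y ^ i := by
    intro i hi2 hin
    rcases (Si i).eq_empty_or_nonempty with he | ⟨p₀, hp₀⟩
    · simp only [q, he, Finset.prod_empty, Nat.cast_one]
      exact one_le_pow₀ hY1
    obtain ⟨m, hmdef⟩ : ∃ m, m = max k (n + 1 - i) := ⟨_, rfl⟩
    have hpm : ∀ p ∈ Si i, m ≤ D.factorization p := by
      intro p hp
      have h1 := (Finset.mem_filter.mp hp).2
      have h2 := (hexp p (Finset.mem_filter.mp (Finset.mem_filter.mp hp).1).1).1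
      omega
    have hm2 : 2 ≤ m := by omega
    have hmn : m + 1 ≤ n := by
      have h1 := hpm p₀ hp₀
      have h2 := hvn p₀ (Finset.mem_filter.mp hp₀).1
      omega
    have hmi : n + 1 ≤ m + i := by
      omega
    have hdvd : q i ^ m ∣ D := by
      conv_rhs => rw [← Nat.prod_factorization_pow_eq_self hD.ne']
      rw [← Finset.prod_pow, Finsupp.prod, Nat.support_factorization]
      refine (Finset.prod_dvd_prod_of_dvd _ (fun p => p ^ D.factorization p)
        fun p hp => pow_dvd_pow _ (hpm p hp)).trans ?_
      exact Finset.prod_dvd_prod_of_subset _ _ _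
        ((Finset.filter_subset _ _).trans (Finset.filter_subset _ _))
    have hle : (q i : ℝ) ^ m ≤ D := by exact_mod_cast Nat.le_of_dvd hD hdvd
    have hexpo : 2 * (n - 1) ≤ i * m := by
      obtain ⟨u, rfl⟩ := Nat.exists_eq_add_of_le hm2
      obtain ⟨v, hv⟩ := Nat.exists_eq_add_of_le hmn
      obtain ⟨w, hw⟩ := Nat.exists_eq_add_of_le hmi
      have h1 : i = v + 2 + w := by omega
      have h2 : n - 1 = u + v + 2 := by omega
      rw [h1, h2]
      nlinarith [Nat.zero_le (u * v), Nat.zero_le (w * u)]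
    refine le_of_pow_le_pow_left₀ (by omega : m ≠ 0) (by positivity) ?_
    rw [← pow_mul]
    calc (q i : ℝ) ^ m ≤ D := hle
      _ = Y ^ (2 * (n - 1)) := hYD.symm
      _ ≤ Y ^ (i * m) := pow_le_pow_right₀ hY1 hexpo
  have hqprod : (D : ℝ) ≤ (∏ i ∈ Finset.Icc 2 n, (q i : ℝ)) * (n : ℝ) ^ (n * E) := by
    have h1 : ∏ i ∈ Finset.Icc 2 n, q i = ∏ p ∈ S, p ^ D.factorization p := by
      simp only [q, Si, Finset.prod_filter]
      rw [Finset.prod_comm]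
      refine Finset.prod_congr rfl fun p hp => ?_
      rw [← Finset.prod_filter, Finset.prod_const]
      congr 1
      have hv := hvn p hp
      have : (Finset.Icc 2 n).filter (fun i => n + 1 ≤ D.factorization p + i) =
          Finset.Icc (n + 1 - D.factorization p) n := by
        ext i
        simp only [Finset.mem_filter, Finset.mem_Icc]
        omega
      rw [this, Nat.card_Icc]
      omega
    have h2 : D = (∏ p ∈ S, p ^ D.factorization p) *
        ∏ p ∈ D.primeFactors.filter (fun p => ¬ n < p), p ^ D.factorization p := by
      conv_lhs => rw [← Nat.prod_factorization_pow_eq_self hD.ne']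
      rw [Finsupp.prod, Nat.support_factorization, hS, Finset.prod_filter_mul_prod_filter_not]
    have h3 : ∏ p ∈ D.primeFactors.filter (fun p => ¬ n < p), p ^ D.factorization p ≤
        n ^ (n * E) := by
      calc ∏ p ∈ D.primeFactors.filter (fun p => ¬ n < p), p ^ D.factorization p
          ≤ ∏ _p ∈ D.primeFactors.filter (fun p => ¬ n < p), n ^ E := by
            refine Finset.prod_le_prod' fun p hp => ?_
            obtain ⟨hp1, hp2⟩ := Finset.mem_filter.mp hp
            exact (Nat.pow_le_pow_left (not_lt.mp hp2) _).trans
              (Nat.pow_le_pow_right (by omega) (hexp p hp1).2)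
        _ = (n ^ E) ^ (D.primeFactors.filter (fun p => ¬ n < p)).card := by simp
        _ ≤ (n ^ E) ^ n := by
            refine Nat.pow_le_pow_right (Nat.pos_of_ne_zero (pow_ne_zero _ (by omega))) ?_
            calc (D.primeFactors.filter (fun p => ¬ n < p)).card ≤ (Finset.Icc 1 n).card := by
                  refine Finset.card_le_card fun p hp => ?_
                  obtain ⟨hp1, hp2⟩ := Finset.mem_filter.mp hp
                  exact Finset.mem_Icc.mpr
                    ⟨(Nat.prime_of_mem_primeFactors hp1).pos, not_lt.mp hp2⟩
              _ = n := by simp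
        _ = n ^ (n * E) := by rw [← pow_mul, mul_comm]
    have h4 : D ≤ (∏ i ∈ Finset.Icc 2 n, q i) * n ^ (n * E) := by
      conv_lhs => rw [h2]
      rw [h1]
      exact Nat.mul_le_mul_left _ h3
    exact_mod_cast h4
  have key := card_le_prod_of_coeff_prefix_card_le T
    (fun f hf => ⟨(hT f hf).1, (hT f hf).2.1, (hT f hf).2.2.1⟩)
    (fun i => (M : ℝ) ^ D.primeFactors.card * (3 * c) * (Y ^ i / q i))
    (fun i => by positivity) ?_
  · refine key.trans ?_
    rw [Finset.prod_mul_distrib, Finset.prod_const, Finset.prod_div_distrib,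
      prod_pow_range_eq_rpow hn hD1 hY, mul_pow, Nat.card_Icc]
    have hQ : 0 < ∏ i ∈ Finset.Icc 2 n, (q i : ℝ) :=
      Finset.prod_pos fun i _ => by exact_mod_cast hqpos i
    have h1 : ((M : ℝ) ^ D.primeFactors.card) ^ (n + 1 - 2) ≤ K * (D : ℝ) ^ ε := by
      refine le_trans ?_ (hK D hD)
      rw [Nat.cast_pow, ← pow_mul, ← pow_mul, mul_comm]
      exact pow_le_pow_right₀ hM1' (Nat.mul_le_mul_right _ (by omega))
    have h2 : (3 * c) ^ (n + 1 - 2) ≤ (3 * c) ^ n := pow_le_pow_right₀ (by linarith) (by omega)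
    have h3 : (D : ℝ) ^ (((n : ℝ) + 2) / 4) / ∏ i ∈ Finset.Icc 2 n, (q i : ℝ) ≤
        (n : ℝ) ^ (n * E) * (D : ℝ) ^ (((n : ℝ) + 2) / 4 - 1) := by
      rw [div_le_iff₀ hQ, Real.rpow_sub_one (by linarith)]
      have hDpos : (0 : ℝ) < D := by linarith
      have h4 : 0 ≤ (D : ℝ) ^ (((n : ℝ) + 2) / 4) / D := by positivity
      calc (D : ℝ) ^ (((n : ℝ) + 2) / 4) = ((D : ℝ) ^ (((n : ℝ) + 2) / 4) / D) * D := by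
            rw [div_mul_cancel₀ _ hDpos.ne']
        _ ≤ ((D : ℝ) ^ (((n : ℝ) + 2) / 4) / D) *
            ((∏ i ∈ Finset.Icc 2 n, (q i : ℝ)) * (n : ℝ) ^ (n * E)) :=
            mul_le_mul_of_nonneg_left hqprod h4
        _ = _ := by ring
    calc _ ≤ K * (D : ℝ) ^ ε * (3 * c) ^ n *
          ((n : ℝ) ^ (n * E) * (D : ℝ) ^ (((n : ℝ) + 2) / 4 - 1)) := by
          refine mul_le_mul (mul_le_mul h1 h2 (by positivity) (by positivity)) h3
            (by positivity) (by positivity)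
      _ = _ := by
          rw [Real.rpow_add (by linarith : (0 : ℝ) < D)]
          ring
  · intro i hi2 hin f₀ hf₀
    set A := (T.filter fun f => ∀ j < i, f.coeff (n - j) = f₀.coeff (n - j)).image
      fun f => f.coeff (n - i) with hA
    have hB : (1 : ℝ) ≤ c * Y ^ i := one_le_mul_of_one_le_of_one_le hc (one_le_pow₀ hY1)
    have h1 := card_le_of_card_image_zmod_le A (B := c * Y ^ i) (by linarith) (Si i)
      (fun p hp => hSprime p (Finset.mem_filter.mp hp).1) ?_ M ?_
    · refine h1.trans ?_
      have hqi : (0 : ℝ) < q i := by exact_mod_cast hqpos i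
      have h2 : (1 : ℝ) ≤ Y ^ i / q i := by
        rw [le_div_iff₀ hqi, one_mul]
        exact hq i hi2 hin
      rw [mul_assoc]
      refine mul_le_mul (pow_le_pow_right₀ hM1' (Finset.card_le_card
        ((Finset.filter_subset _ _).trans (Finset.filter_subset _ _)))) ?_ (by positivity)
        (by positivity)
      calc 2 * (c * Y ^ i) / (q i : ℝ) + 1 = 2 * c * (Y ^ i / q i) + 1 := by ring
        _ ≤ 2 * c * (Y ^ i / q i) + c * (Y ^ i / q i) := by
            have := one_le_mul_of_one_le_of_one_le hc h2
            linarith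
        _ = 3 * c * (Y ^ i / q i) := by ring
    · intro a ha
      obtain ⟨f, hf, rfl⟩ := Finset.mem_image.mp ha
      exact (hT f (Finset.mem_filter.mp hf).1).2.2.2 i hin
    · intro p hp
      obtain ⟨hpS, hpi⟩ := Finset.mem_filter.mp hp
      obtain ⟨hpD, hpn⟩ := Finset.mem_filter.mp hpS
      obtain ⟨F, _, _, hF⟩ := hroots p hpD hpn
      have : Fact p.Prime := ⟨hSprime p hpS⟩
      let φ : ZMod p →+* F := ZMod.castHom dvd_rfl F
      have hφ : Function.Injective φ := φ.injective
      set U := (T.filter fun f => ∀ j < i, f.coeff (n - j) = f₀.coeff (n - j)).image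
        fun f => f.map (Int.castRingHom F) with hU
      have hUcard : U.card ≤ M := by
        refine card_prod_X_sub_C_le_rootPatternBound (p := p) hpn (d := i - 1) (by omega)
          (fun j => ((f₀.coeff (n - j) : ℤ) : F)) U ?_
        intro g hg
        obtain ⟨f, hf, rfl⟩ := Finset.mem_image.mp hg
        obtain ⟨hfT, hpre⟩ := Finset.mem_filter.mp hf
        obtain ⟨x, hx1, hx2⟩ := hF f hfT
        refine ⟨x, hx1, by omega, fun j hj1 hj2 => ?_⟩
        rw [coeff_map, hpre j (by omega)]
        simp
      refine le_trans ?_ hUcard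
      rw [← Finset.card_image_of_injective _ hφ]
      refine (Finset.card_le_card ?_).trans (Finset.card_image_le (s := U)
        (f := fun g => g.coeff (n - i)))
      intro b hb
      obtain ⟨b', hb', rfl⟩ := Finset.mem_image.mp hb
      obtain ⟨a, ha, rfl⟩ := Finset.mem_image.mp hb'
      obtain ⟨f, hf, rfl⟩ := Finset.mem_image.mp ha
      refine Finset.mem_image.mpr ⟨f.map (Int.castRingHom F), Finset.mem_image_of_mem _ hf, ?_⟩
      simp

open NumberField in
theorem NumberField.minkowskiBound_one_le (K : Type*) [Field K] [NumberField K] :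
    mixedEmbedding.minkowskiBound K ↑1 ≤
      ((NNReal.sqrt (discr K).natAbs * 2 ^ Module.finrank ℚ K : NNReal) : ENNReal) := by
  rw [mixedEmbedding.minkowskiBound,
    mixedEmbedding.volume_fundamentalDomain_fractionalIdealLatticeBasis,
    Units.val_one, FractionalIdeal.absNorm_one, Rat.cast_one,
    ENNReal.ofReal_one, one_mul, mixedEmbedding.finrank,
    mixedEmbedding.volume_fundamentalDomain_latticeBasis,
    ENNReal.coe_mul, ENNReal.coe_pow, ENNReal.coe_ofNat]
  refine mul_le_mul_left ?_ _
  refine (mul_le_of_le_one_left' (pow_le_one₀ (by positivity) (by simp))).trans ?_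
  refine ENNReal.coe_le_coe.mpr (NNReal.sqrt_le_sqrt.mpr (le_of_eq ?_))
  rw [← NNReal.coe_inj, coe_nnnorm, Int.norm_eq_abs, ← Int.cast_abs, NNReal.coe_natCast,
    Nat.cast_natAbs]

open NumberField InfinitePlace in
/-- Minkowski: a non-rational integer all of whose conjugates are small. -/
theorem NumberField.exists_small_integer_notMem_bot (K : Type*) [Field K] [NumberField K]
    (hn : 2 ≤ Module.finrank ℚ K) :
    ∃ a : 𝓞 K, (a : K) ∉ (⊥ : IntermediateField ℚ K) ∧ ∀ w : InfinitePlace K,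
      w a ≤ 16 * ((discr K).natAbs : ℝ) ^ (1 / (2 * ((Module.finrank ℚ K : ℝ) - 1))) := by
  set n := Module.finrank ℚ K with hndef
  set D : ℝ := ((discr K).natAbs : ℝ) with hD
  have hD1 : 1 ≤ D := by
    rw [hD]
    exact_mod_cast Int.natAbs_pos.mpr (discr_ne_zero K)
  set Y : ℝ := D ^ (1 / (2 * ((n : ℝ) - 1))) with hY
  have hn' : (2 : ℝ) ≤ n := by exact_mod_cast hn
  have hY1 : 1 ≤ Y := Real.one_le_rpow hD1 (by apply div_nonneg <;> linarith)
  have hYD : Y ^ (n - 1) = Real.sqrt D := by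
    rw [hY, ← Real.rpow_natCast, ← Real.rpow_mul (by linarith), Real.sqrt_eq_rpow]
    push_cast [Nat.cast_sub (show 1 ≤ n by omega)]
    congr 1
    have : (n : ℝ) - 1 ≠ 0 := by linarith
    field_simp
  let B : NNReal := ⟨8 * Y, by positivity⟩
  have hBval : (B : ℝ) = 8 * Y := rfl
  have hB1 : 1 ≤ B := by
    rw [← NNReal.coe_le_coe]
    simp only [hBval, NNReal.coe_one]
    linarith
  have hBlt : mixedEmbedding.minkowskiBound K ↑1 < ((B ^ (n - 1) : NNReal) : ENNReal) := by
    refine (minkowskiBound_one_le K).trans_lt (ENNReal.coe_lt_coe.mpr ?_)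
    rw [← NNReal.coe_lt_coe]
    push_cast
    rw [hBval, mul_pow, hYD, mul_comm, ← hD]
    refine mul_lt_mul_of_pos_right ?_ (Real.sqrt_pos.mpr (by linarith))
    calc (2 : ℝ) ^ n < 2 ^ (3 * (n - 1)) := pow_lt_pow_right₀ (by norm_num) (by omega)
      _ = 8 ^ (n - 1) := by rw [pow_mul]; norm_num
  have hmult : ∀ w₀ : InfinitePlace K, ∀ b : NNReal, b ^ mult w₀ * B ^ (n - mult w₀) =
      ∏ w : InfinitePlace K, (if w = w₀ then b else B) ^ mult w := by
    intro w₀ b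
    rw [← Finset.mul_prod_erase _ _ (Finset.mem_univ w₀), if_pos rfl]
    congr 1
    rw [Finset.prod_congr rfl (g := fun w => B ^ mult w)
      (fun w hw => by rw [if_neg (Finset.ne_of_mem_erase hw)]), Finset.prod_pow_eq_pow_sum]
    congr 1
    have := Finset.add_sum_erase Finset.univ (fun w : InfinitePlace K => mult w)
      (Finset.mem_univ w₀)
    rw [sum_mult_eq] at this
    omega
  have hrat : ∀ a : 𝓞 K, a ≠ 0 → (a : K) ∈ (⊥ : IntermediateField ℚ K) →
      ∃ z : ℤ, (a : K) = z ∧ 1 ≤ |(z : ℝ)| := by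
    intro a ha0 ha
    obtain ⟨q, hq⟩ := IntermediateField.mem_bot.mp ha
    have hxint : IsIntegral ℤ q := by
      have : IsIntegral ℤ (a : K) := a.isIntegral_coe
      rw [← hq] at this
      exact (isIntegral_algebraMap_iff (algebraMap ℚ K).injective).mp this
    obtain ⟨z, hz⟩ := IsIntegrallyClosed.isIntegral_iff.mp hxint
    refine ⟨z, by rw [← hq, ← hz]; simp, ?_⟩
    have hz0 : z ≠ 0 := by
      rintro rfl
      apply ha0
      apply RingOfIntegers.coe_injective
      exact hq.symm.trans (by rw [← hz]; simp)
    exact_mod_cast Int.one_le_abs hz0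
  obtain ⟨w₀⟩ : Nonempty (InfinitePlace K) := inferInstance
  rcases isReal_or_isComplex w₀ with hw₀ | hw₀
  · have hvol : mixedEmbedding.minkowskiBound K ↑1 < MeasureTheory.volume
        (mixedEmbedding.convexBodyLT K (fun w => if w = w₀ then 1 else B)) := by
      rw [mixedEmbedding.convexBodyLT_volume]
      have h1 := hmult w₀ 1
      rw [one_pow, one_mul, mult_isReal ⟨w₀, hw₀⟩] at h1
      refine hBlt.trans_le ?_
      rw [h1]
      simp only [ENNReal.ofNNReal_finsetProd, ENNReal.coe_pow]
      refine le_mul_of_one_le_left (by positivity) ?_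
      exact ENNReal.one_le_coe_iff.mpr (mixedEmbedding.one_le_convexBodyLTFactor K)
    obtain ⟨a, ha0, ha⟩ := mixedEmbedding.exists_ne_zero_mem_ringOfIntegers_lt K hvol
    refine ⟨a, fun hbot => ?_, fun w => ?_⟩
    · obtain ⟨z, hz, hz1⟩ := hrat a ha0 hbot
      have h1 := ha w₀
      rw [if_pos rfl, hz, ← norm_embedding_eq, map_intCast, Complex.norm_intCast] at h1
      push_cast at h1
      linarith
    · refine (ha w).le.trans ?_
      split_ifs
      · push_cast; linarith
      · rw [hBval]; linarith
  · have hvol : mixedEmbedding.minkowskiBound K ↑1 < MeasureTheory.volume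
        (mixedEmbedding.convexBodyLT' K (fun w => if w = w₀ then NNReal.sqrt B else B)
          ⟨w₀, hw₀⟩) := by
      rw [mixedEmbedding.convexBodyLT'_volume]
      have h1 := hmult w₀ (NNReal.sqrt B)
      rw [mult_isComplex ⟨w₀, hw₀⟩, NNReal.sq_sqrt, ← pow_succ',
        show n - 2 + 1 = n - 1 by omega] at h1
      refine hBlt.trans_le ?_
      rw [h1]
      simp only [ENNReal.ofNNReal_finsetProd, ENNReal.coe_pow]
      refine le_mul_of_one_le_left (by positivity) ?_
      exact ENNReal.one_le_coe_iff.mpr (mixedEmbedding.one_le_convexBodyLT'Factor K)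
    obtain ⟨a, ha0, ha, hre, him⟩ := mixedEmbedding.exists_ne_zero_mem_ringOfIntegers_lt' K
      ⟨w₀, hw₀⟩ hvol
    refine ⟨a, fun hbot => ?_, fun w => ?_⟩
    · obtain ⟨z, hz, hz1⟩ := hrat a ha0 hbot
      rw [hz, map_intCast, Complex.intCast_re] at hre
      linarith
    · by_cases hw : w = w₀
      · subst hw
        rw [← norm_embedding_eq]
        refine (Complex.norm_le_abs_re_add_abs_im _).trans ?_
        have hsq : ((NNReal.sqrt B : NNReal) : ℝ) ^ 2 = B := by
          exact_mod_cast congrArg NNReal.toReal (NNReal.sq_sqrt B)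
        simp only [if_true] at him hre
        rw [hsq, hBval] at him
        linarith
      · have := ha w hw
        simp only [if_neg hw, hBval] at this
        linarith

open NumberField in
/-- Minkowski: a non-rational integer of trace zero all of whose conjugates are small. -/
theorem NumberField.exists_small_integer_trace_zero (K : Type*) [Field K] [NumberField K]
    (hn : 2 ≤ Module.finrank ℚ K) :
    ∃ a : 𝓞 K, (a : K) ∉ (⊥ : IntermediateField ℚ K) ∧ Algebra.trace ℚ K a = 0 ∧
      ∀ σ : K →+* ℂ, ‖σ a‖ ≤ 32 * Module.finrank ℚ K *
        ((discr K).natAbs : ℝ) ^ (1 / (2 * ((Module.finrank ℚ K : ℝ) - 1))) := by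
  obtain ⟨a, ha, hbd⟩ := exists_small_integer_notMem_bot K hn
  set n := Module.finrank ℚ K with hndef
  set Y := ((discr K).natAbs : ℝ) ^ (1 / (2 * ((n : ℝ) - 1)))
  have hσ : ∀ σ : K →+* ℂ, ‖σ a‖ ≤ 16 * Y := fun σ => hbd (InfinitePlace.mk σ)
  have htr : (Algebra.trace ℤ (𝓞 K) a : ℚ) = Algebra.trace ℚ K a := by
    rw [Algebra.coe_trace_int]
  have htrbd : ‖((Algebra.trace ℤ (𝓞 K) a : ℤ) : ℂ)‖ ≤ n * (16 * Y) := by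
    have h1 : ((Algebra.trace ℤ (𝓞 K) a : ℤ) : ℂ) = ∑ σ : K →ₐ[ℚ] ℂ, σ a := by
      rw [← trace_eq_sum_embeddings ℂ, ← htr]; simp
    rw [h1]
    refine (norm_sum_le _ _).trans ?_
    refine (Finset.sum_le_card_nsmul _ _ (16 * Y) fun σ _ => hσ σ.toRingHom).trans_eq ?_
    rw [Finset.card_univ, AlgHom.card, nsmul_eq_mul]
  refine ⟨n * a - (Algebra.trace ℤ (𝓞 K) a : ℤ), ?_, ?_, ?_⟩
  · intro hmem
    apply ha
    have h1 : (a : K) = (n : K)⁻¹ * (((n * a - (Algebra.trace ℤ (𝓞 K) a : ℤ) : 𝓞 K) : K) +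
        (Algebra.trace ℤ (𝓞 K) a : ℤ)) := by
      have : (n : K) ≠ 0 := Nat.cast_ne_zero.mpr (by omega)
      push_cast
      field_simp
      simp
    rw [h1]
    exact mul_mem (inv_mem (natCast_mem _ _)) (add_mem hmem (intCast_mem _ _))
  · have h1 : (((n * a - (Algebra.trace ℤ (𝓞 K) a : ℤ) : 𝓞 K) : K)) =
        (n : ℚ) • (a : K) - algebraMap ℚ K (Algebra.trace ℚ K a) := by
      rw [← htr]
      simp [Algebra.smul_def]
    rw [h1, map_sub, map_smul, Algebra.trace_algebraMap, ← hndef]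
    simp
  · intro σ
    have h1 : σ ((n * a - (Algebra.trace ℤ (𝓞 K) a : ℤ) : 𝓞 K) : K) =
        n * σ a - ((Algebra.trace ℤ (𝓞 K) a : ℤ) : ℂ) := by simp
    rw [h1]
    refine (norm_sub_le _ _).trans ?_
    rw [norm_mul, Complex.norm_natCast]
    have := mul_le_mul_of_nonneg_left (hσ σ) (Nat.cast_nonneg (α := ℝ) n)
    linarith

theorem ZMod.isLocalRing_pow (p N : ℕ) [Fact p.Prime] (hN : 1 ≤ N) : IsLocalRing (ZMod (p ^ N)) := by
  have : Nontrivial (ZMod (p ^ N)) :=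
    ZMod.nontrivial_iff.2 (Nat.one_lt_pow (by lia) (Fact.out : p.Prime).one_lt).ne'
  exact IsLocalRing.of_surjective' (PadicInt.toZModPow (p := p) N) (ZMod.ringHom_surjective _)

open scoped TensorProduct in
/-- An element that is idempotent modulo `p ^ N` and not in every maximal ideal over `p` has trace
not divisible by `p ^ N`, as soon as `p ^ N` exceeds the rank. -/
theorem not_dvd_trace_of_idempotent_mod {O : Type*} [CommRing O] [Module.Free ℤ O]
    [Module.Finite ℤ O] (p N : ℕ) [Fact p.Prime] (hN : 1 ≤ N) (hpN : Module.finrank ℤ O < p ^ N)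
    {I J : Ideal O} (hIJ : I * J = Ideal.span {(p ^ N : O)}) (hI : I ≠ ⊤) {x : O}
    (hxI : x - 1 ∈ I) (hxJ : x ∈ J) :
    ¬ ((p ^ N : ℕ) : ℤ) ∣ Algebra.trace ℤ O x := by
  have := ZMod.isLocalRing_pow p N hN
  set R := ZMod (p ^ N) with hR
  set φ : O →ₗ[ℤ] O := LinearMap.mulLeft ℤ x
  set ψ := φ.baseChange R
  have hnat : ((p ^ N : ℕ) : R) = 0 := ZMod.natCast_self _
  have hx2 : ∃ y, x * x - x = (p ^ N : ℕ) • y := by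
    have h : x * x - x ∈ Ideal.span {(p ^ N : O)} := by
      rw [← hIJ, show x * x - x = (x - 1) * x by ring]
      exact Ideal.mul_mem_mul hxI hxJ
    obtain ⟨y, hy⟩ := Ideal.mem_span_singleton'.1 h
    exact ⟨y, by rw [← hy, nsmul_eq_mul]; push_cast; ring⟩
  have hidem : IsIdempotentElem ψ := by
    obtain ⟨y, hy⟩ := hx2
    have h : φ * φ = φ + (p ^ N : ℕ) • LinearMap.mulLeft ℤ y := by
      ext z
      have : x * (x * z) = x * z + (p ^ N : ℕ) • (y * z) := by
        rw [← smul_mul_assoc, ← hy]; ring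
      simpa [φ, -nsmul_eq_mul] using this
    have h2 : ψ * ψ = (φ * φ).baseChange R := (LinearMap.baseChange_mul ..).symm
    have h3 : (p ^ N : ℕ) • (LinearMap.mulLeft ℤ y).baseChange R = 0 := by
      rw [← Nat.cast_smul_eq_nsmul R, hnat, zero_smul]
    have h4 : ((p ^ N : ℕ) • LinearMap.mulLeft ℤ y).baseChange R = 0 := by
      rw [← h3]; ext; simp [-nsmul_eq_mul, TensorProduct.tmul_smul]
    rw [IsIdempotentElem, h2, h, LinearMap.baseChange_add, h4, add_zero]
  have hproj := LinearMap.IsIdempotentElem.isProj_range _ hidem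
  have hfix : ∀ z, ψ (ψ z) = ψ z := fun z => congrArg (fun f => f z) hidem
  have : NeZero (p ^ N) := ⟨pow_ne_zero _ (Fact.out : p.Prime).ne_zero⟩
  have : IsNoetherianRing R := inferInstanceAs (IsNoetherianRing (ZMod (p ^ N)))
  have : Module.Projective R (LinearMap.range ψ) :=
    Module.Projective.of_split (LinearMap.range ψ).subtype ψ.rangeRestrict (by
      ext ⟨_, z, rfl⟩; simp [hfix])
  have : Module.Projective R (LinearMap.ker ψ) :=
    Module.Projective.of_split (LinearMap.ker ψ).subtype
      ((LinearMap.id - ψ).codRestrict (LinearMap.ker ψ) (fun z => by simp [hfix])) (by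
        ext ⟨z, hz⟩; simpa using hz)
  have : Module.Free R (LinearMap.range ψ) := Module.free_of_flat_of_isLocalRing
  have : Module.Free R (LinearMap.ker ψ) := Module.free_of_flat_of_isLocalRing
  have htr : algebraMap ℤ R (Algebra.trace ℤ O x) = Module.finrank R (LinearMap.range ψ) := by
    rw [← hproj.trace]
    exact (LinearMap.trace_baseChange φ R).symm
  intro hdvd
  have hzero : ((Module.finrank R (LinearMap.range ψ) : ℕ) : R) = 0 := by
    rw [← htr]
    exact (ZMod.intCast_zmod_eq_zero_iff_dvd _ _).2 hdvd
  have hdvd' : p ^ N ∣ Module.finrank R (LinearMap.range ψ) :=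
    (ZMod.natCast_eq_zero_iff _ _).1 hzero
  have hle : Module.finrank R (LinearMap.range ψ) ≤ Module.finrank ℤ O := by
    refine (Submodule.finrank_le _).trans ?_
    rw [Module.finrank_baseChange]
  have h0 : Module.finrank R (LinearMap.range ψ) = 0 :=
    Nat.eq_zero_of_dvd_of_lt hdvd' (hle.trans_lt hpN)
  have hψ0 : ψ = 0 := by
    rw [← LinearMap.range_eq_bot]
    have := Module.finrank_eq_zero_iff_of_free (R := R) (M := LinearMap.range ψ)
    exact (Submodule.subsingleton_iff_eq_bot).1 (this.1 h0)
  have hchar : ((p ^ N : ℕ) : O ⧸ I) = 0 := by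
    rw [← map_natCast (Ideal.Quotient.mk I), Ideal.Quotient.eq_zero_iff_mem]
    have : (p ^ N : O) ∈ I * J := hIJ ▸ Ideal.mem_span_singleton_self _
    push_cast
    exact Ideal.mul_le_left this
  have hdvdc : ringChar (O ⧸ I) ∣ p ^ N := (ringChar.spec _ _).1 hchar
  have hval := congrArg (Algebra.TensorProduct.productMap
    (ZMod.castHom hdvdc (O ⧸ I)).toIntAlgHom (Ideal.Quotient.mk I).toIntAlgHom)
    (congrArg (fun f => f (1 ⊗ₜ 1)) hψ0)
  have hx1 : Ideal.Quotient.mk I x = 1 := by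
    rw [← map_one (Ideal.Quotient.mk I)]
    exact Ideal.Quotient.eq.2 hxI
  have hone : (1 : O ⧸ I) = 0 := by
    simpa [ψ, φ, hx1, -ZMod.castHom_apply] using hval
  have : Nontrivial (O ⧸ I) := Ideal.Quotient.nontrivial_iff.2 hI
  exact one_ne_zero hone

section

open NumberField UniqueFactorizationMonoid

variable (K : Type*) [Field K] [NumberField K] (p : ℕ) [Fact p.Prime]

theorem NumberField.mem_of_dvd_absNorm {Q : Ideal (𝓞 K)} (hQ : Q.IsPrime) (hQ0 : Q ≠ ⊥)
    (h : p ∣ Ideal.absNorm Q) : (p : 𝓞 K) ∈ Q := by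
  have hp : p.Prime := Fact.out
  have hN0 : Ideal.absNorm Q ≠ 0 := by rwa [Ne, Ideal.absNorm_eq_zero_iff]
  have hmem : ((Ideal.absNorm Q : ℕ) : 𝓞 K) ∈ Q := Ideal.absNorm_mem Q
  obtain ⟨q, hq, hqQ⟩ : ∃ q : ℕ, q.Prime ∧ (q : 𝓞 K) ∈ Q := by
    by_contra! hcon
    have key : ∀ m : ℕ, m ≠ 0 → (m : 𝓞 K) ∉ Q := by
      intro m
      induction m using Nat.recOnMul with
      | zero => simp
      | one => simpa using hQ.one_notMem
      | prime q hq => exact fun _ => hcon q hq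
      | mul a b ha hb =>
        intro hab hmem
        rw [Nat.cast_mul] at hmem
        rcases hQ.mem_or_mem hmem with h | h
        · exact ha (left_ne_zero_of_mul hab) h
        · exact hb (right_ne_zero_of_mul hab) h
    exact key _ hN0 hmem
  have hdvd : Ideal.absNorm Q ∣ q ^ Module.finrank ℤ (𝓞 K) := by
    have := Ideal.absNorm_dvd_absNorm_of_le ((Ideal.span_singleton_le_iff_mem Q).2 hqQ)
    rwa [Ideal.absNorm_span_natCast] at this
  rwa [(Nat.prime_dvd_prime_iff_eq hp hq).1 (hp.dvd_of_dvd_pow (h.trans hdvd))]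

theorem NumberField.factorization_absNorm {I : Ideal (𝓞 K)} (hI : I ≠ ⊥) :
    (Ideal.absNorm I).factorization p =
      ∑ Q ∈ (normalizedFactors (Ideal.span {(p : 𝓞 K)})).toFinset,
        (normalizedFactors I).count Q * (Ideal.absNorm Q).factorization p := by
  have hp0 : Ideal.span {(p : 𝓞 K)} ≠ ⊥ := by
    simpa using (Fact.out : p.Prime).ne_zero
  have hprime : ∀ Q ∈ normalizedFactors I, Q ≠ ⊥ ∧ Q.IsPrime := fun Q hQ =>
    ⟨(prime_of_normalized_factor Q hQ).ne_zero,
      Ideal.isPrime_of_prime (prime_of_normalized_factor Q hQ)⟩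
  have h1 : Ideal.absNorm I =
      ∏ Q ∈ (normalizedFactors I).toFinset, Ideal.absNorm Q ^ (normalizedFactors I).count Q := by
    conv_lhs => rw [← Ideal.prod_normalizedFactors_eq_self hI]
    rw [map_multiset_prod, Finset.prod_multiset_map_count]
  rw [h1, Nat.factorization_prod_apply fun Q hQ => pow_ne_zero _ (by
    rw [Ne, Ideal.absNorm_eq_zero_iff]; exact (hprime Q (Multiset.mem_toFinset.1 hQ)).1)]
  simp only [Nat.factorization_pow, Finsupp.smul_apply, smul_eq_mul]
  rw [Finset.sum_subset (Finset.subset_union_left (s₂ :=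
    (normalizedFactors (Ideal.span {(p : 𝓞 K)})).toFinset)),
    ← Finset.sum_subset (Finset.subset_union_right (s₁ := (normalizedFactors I).toFinset))]
  · intro Q hQ hQp
    have hQI : Q ∈ normalizedFactors I := by
      simp only [Finset.mem_union, Multiset.mem_toFinset] at hQ hQp; tauto
    obtain ⟨hQ0, hQpr⟩ := hprime Q hQI
    refine mul_eq_zero_of_right _ (Nat.factorization_eq_zero_of_not_dvd fun hdvd => hQp ?_)
    rw [Multiset.mem_toFinset, Ideal.mem_normalizedFactors_iff hp0]
    exact ⟨hQpr, by simpa [Ideal.span_singleton_le_iff_mem] using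
      mem_of_dvd_absNorm K p hQpr hQ0 hdvd⟩
  · intro Q _ hQ
    rw [Multiset.count_eq_zero_of_notMem (by rwa [Multiset.mem_toFinset] at hQ), zero_mul]

theorem NumberField.count_differentIdeal_bounds {Q : Ideal (𝓞 K)}
    (hQ : Q ∈ normalizedFactors (Ideal.span {(p : 𝓞 K)})) :
    (normalizedFactors (Ideal.span {(p : 𝓞 K)})).count Q ≤
      (normalizedFactors (differentIdeal ℤ (𝓞 K))).count Q + 1 ∧
    ((normalizedFactors (Ideal.span {(p : 𝓞 K)})).count Q = 1 →
      (normalizedFactors (differentIdeal ℤ (𝓞 K))).count Q = 0) ∧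
    ∀ N, 1 ≤ N → Module.finrank ℚ K < p ^ N →
      (normalizedFactors (differentIdeal ℤ (𝓞 K))).count Q <
        (normalizedFactors (Ideal.span {(p : 𝓞 K)})).count Q * N := by
  have hp0 : Ideal.span {(p : 𝓞 K)} ≠ ⊥ := by
    simpa using (Fact.out : p.Prime).ne_zero
  have hd0 : differentIdeal ℤ (𝓞 K) ≠ ⊥ := differentIdeal_ne_bot
  have hQp : Prime Q := prime_of_normalized_factor Q hQ
  have hdvd : ∀ {I : Ideal (𝓞 K)}, I ≠ ⊥ → ∀ m, Q ^ m ∣ I ↔ m ≤ (normalizedFactors I).count Q := by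
    intro I hI m
    rw [UniqueFactorizationMonoid.dvd_iff_normalizedFactors_le_normalizedFactors
      (pow_ne_zero _ hQp.ne_zero) hI, normalizedFactors_pow, normalizedFactors_irreducible
      hQp.irreducible, normalize_eq, Multiset.nsmul_singleton, ← Multiset.le_count_iff_replicate_le]
  set e := (normalizedFactors (Ideal.span {(p : 𝓞 K)})).count Q with he
  have he1 : 1 ≤ e := Multiset.one_le_count_iff_mem.2 hQ
  have hmap : ∀ m : ℕ, Ideal.map (algebraMap ℤ (𝓞 K)) (Ideal.span {(m : ℤ)}) =
      Ideal.span {(m : 𝓞 K)} := by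
    intro m; simp [Ideal.map_span]
  have hpmax : (Ideal.span {(p : ℤ)}).IsMaximal :=
    PrincipalIdealRing.isMaximal_of_irreducible (Nat.prime_iff_prime_int.1 Fact.out).irreducible
  obtain ⟨J, hJ⟩ := (hdvd hp0 e).2 le_rfl
  have hQJ : ¬ Q ∣ J := by
    rintro ⟨J', rfl⟩
    have : Q ^ (e + 1) ∣ Ideal.span {(p : 𝓞 K)} := ⟨J', by rw [hJ]; ring⟩
    have := (hdvd hp0 _).1 this
    lia
  have hQm : Q.IsMaximal := (Ideal.isPrime_of_prime hQp).isMaximal hQp.ne_zero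
  have hcop : IsCoprime Q J := by
    rw [Ideal.isCoprime_iff_sup_eq]
    exact hQm.1.2 _ (left_lt_sup.2 fun h => hQJ (Ideal.dvd_iff_le.2 h))
  refine ⟨?_, fun he => ?_, fun N hN hpN => ?_⟩
  · have h := pow_sub_one_dvd_differentIdeal ℤ (p := Ideal.span {(p : ℤ)}) Q e (by
      simpa using (Fact.out : p.Prime).ne_zero) (by rw [hmap]; exact (hdvd hp0 _).2 le_rfl)
    have := (hdvd hd0 _).1 h
    lia
  · have : Finite (ℤ ⧸ Ideal.span {(p : ℤ)}) :=
      Ideal.finiteQuotientOfFreeOfNeBot _ (by simpa using (Fact.out : p.Prime).ne_zero)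
    have hnd := not_dvd_differentIdeal_of_isCoprime ℤ (p := Ideal.span {(p : ℤ)}) Q J hcop
      (by rw [hmap, hJ, he, pow_one])
    rw [← pow_one Q, hdvd hd0] at hnd
    lia
  · have hcop : IsCoprime (Q ^ (e * N)) (J ^ N) := hcop.pow
    have hIJ : Q ^ (e * N) * J ^ N = Ideal.span {(p ^ N : 𝓞 K)} := by
      rw [pow_mul, ← mul_pow, ← hJ, Ideal.span_singleton_pow]
    obtain ⟨i, hi, j, hj, hij⟩ := Ideal.isCoprime_iff_exists.1 hcop
    have htr := not_dvd_trace_of_idempotent_mod p N hN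
      (by rwa [RingOfIntegers.rank]) hIJ (fun htop => by
        have : Q ^ (e * N) ≤ Q := Ideal.pow_le_self (Nat.mul_pos he1 hN).ne'
        exact hQm.ne_top (top_le_iff.1 (htop ▸ this)))
      (x := j) (by
        rw [show j - 1 = -i by rw [← hij]; ring]
        exact neg_mem hi) hj
    have hnd := not_dvd_differentIdeal_of_intTrace_not_mem ℤ (p := Ideal.span {((p ^ N : ℕ) : ℤ)})
      (Q ^ (e * N)) (J ^ N) (by rw [hmap, hIJ]; push_cast; rfl) j hj (by
        rw [Ideal.mem_span_singleton, Algebra.intTrace_eq_trace]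
        exact htr)
    rw [hdvd hd0] at hnd
    lia

theorem NumberField.factorization_discr_bounds :
    let d := ∑ Q ∈ (normalizedFactors (Ideal.span {(p : 𝓞 K)})).toFinset,
      (Ideal.absNorm Q).factorization p
    Module.finrank ℚ K ≤ (discr K).natAbs.factorization p + d ∧
    (Module.finrank ℚ K < p → (discr K).natAbs.factorization p + d ≤ Module.finrank ℚ K) ∧
    (discr K).natAbs.factorization p ≤ Module.finrank ℚ K * Module.finrank ℚ K ∧
    ((discr K).natAbs.factorization p ≠ 0 → d < Module.finrank ℚ K) ∧ 0 < d := by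
  intro d
  have hp : p.Prime := Fact.out
  have hp0 : Ideal.span {(p : 𝓞 K)} ≠ ⊥ := by simpa using hp.ne_zero
  have hd0 : differentIdeal ℤ (𝓞 K) ≠ ⊥ := differentIdeal_ne_bot
  have hD := factorization_absNorm K p hd0
  rw [NumberField.absNorm_differentIdeal (K := K)] at hD
  have hn : Module.finrank ℚ K = ∑ Q ∈ (normalizedFactors (Ideal.span {(p : 𝓞 K)})).toFinset,
      (normalizedFactors (Ideal.span {(p : 𝓞 K)})).count Q * (Ideal.absNorm Q).factorization p := by
    rw [← factorization_absNorm K p hp0, Ideal.absNorm_span_natCast, hp.factorization_pow,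
      RingOfIntegers.rank, Finsupp.single_eq_same]
  have hcount := fun Q hQ => count_differentIdeal_bounds K p (Q := Q) (Multiset.mem_toFinset.1 hQ)
  refine ⟨?_, fun hpn => ?_, ?_, fun hne => ?_, Nat.pos_of_ne_zero fun hzero => ?_⟩
  · rw [hD, ← Finset.sum_add_distrib, hn]
    refine Finset.sum_le_sum fun Q hQ => ?_
    rw [← Nat.succ_mul]
    exact Nat.mul_le_mul_right _ (hcount Q hQ).1
  · rw [hD, ← Finset.sum_add_distrib]
    conv_rhs => rw [hn]
    refine Finset.sum_le_sum fun Q hQ => ?_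
    rw [← Nat.succ_mul]
    have := (hcount Q hQ).2.2 1 le_rfl (by simpa using hpn)
    exact Nat.mul_le_mul_right _ (by lia)
  · rw [hD]
    conv_rhs => enter [1]; rw [hn]
    rw [Finset.sum_mul]
    refine Finset.sum_le_sum fun Q hQ => ?_
    have := (hcount Q hQ).2.2 (Module.finrank ℚ K) Module.finrank_pos (Nat.lt_pow_self hp.one_lt)
    rw [mul_right_comm]
    exact Nat.mul_le_mul_right _ this.le
  · rw [hD] at hne
    obtain ⟨Q, hQ, hQ0⟩ := Finset.exists_ne_zero_of_sum_ne_zero hne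
    have hpos : ∀ Q ∈ (normalizedFactors (Ideal.span {(p : 𝓞 K)})).toFinset,
        1 ≤ (normalizedFactors (Ideal.span {(p : 𝓞 K)})).count Q := fun Q hQ =>
      Multiset.one_le_count_iff_mem.2 (Multiset.mem_toFinset.1 hQ)
    rw [hn]
    refine Finset.sum_lt_sum (fun Q hQ => Nat.le_mul_of_pos_left _ (hpos Q hQ)) ⟨Q, hQ, ?_⟩
    have h1 : (normalizedFactors (Ideal.span {(p : 𝓞 K)})).count Q ≠ 1 := fun h =>
      left_ne_zero_of_mul hQ0 ((hcount Q hQ).2.1 h)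
    have h2 := hpos Q hQ
    exact lt_mul_of_one_lt_left (Nat.pos_of_ne_zero (right_ne_zero_of_mul hQ0)) (by lia)
  · refine (Module.finrank_pos (R := ℚ) (M := K)).ne' (hn.trans (Finset.sum_eq_zero fun Q hQ => ?_))
    rw [Finset.sum_eq_zero_iff.1 hzero Q hQ, mul_zero]

end

section

open NumberField UniqueFactorizationMonoid

variable (K : Type*) [Field K] [NumberField K] (p : ℕ) [Fact p.Prime]
  (Ω : Type*) [Field Ω] [IsAlgClosed Ω] [CharP Ω p]

theorem NumberField.finite_ringHom_and_card_eq :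
    Finite (𝓞 K →+* Ω) ∧ Nat.card (𝓞 K →+* Ω) =
      ∑ Q ∈ (normalizedFactors (Ideal.span {(p : 𝓞 K)})).toFinset,
        (Ideal.absNorm Q).factorization p := by
  have hp : p.Prime := Fact.out
  have hp0 : Ideal.span {(p : 𝓞 K)} ≠ ⊥ := by simpa using hp.ne_zero
  set S := (normalizedFactors (Ideal.span {(p : 𝓞 K)})).toFinset
  have hker : ∀ φ : 𝓞 K →+* Ω, RingHom.ker φ ∈ S := fun φ => by
    rw [Multiset.mem_toFinset, Ideal.mem_normalizedFactors_iff hp0]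
    refine ⟨RingHom.ker_isPrime φ, ?_⟩
    rw [Ideal.span_singleton_le_iff_mem, RingHom.mem_ker, map_natCast, CharP.cast_eq_zero]
  have hfib : ∀ Q ∈ S, Finite {φ : 𝓞 K →+* Ω // RingHom.ker φ = Q} ∧
      Nat.card {φ : 𝓞 K →+* Ω // RingHom.ker φ = Q} = (Ideal.absNorm Q).factorization p := by
    intro Q hQ
    rw [Multiset.mem_toFinset, Ideal.mem_normalizedFactors_iff hp0,
      Ideal.span_singleton_le_iff_mem] at hQ
    obtain ⟨hQp, hpQ⟩ := hQ
    have hQ0 : Q ≠ ⊥ := by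
      rintro rfl
      exact hp.ne_zero (by simpa using hpQ)
    have : Q.IsMaximal := hQp.isMaximal hQ0
    let _ : Field (𝓞 K ⧸ Q) := Ideal.Quotient.field Q
    have hchar : CharP (𝓞 K ⧸ Q) p := by
      have h0 : (p : 𝓞 K ⧸ Q) = 0 := by
        rw [← map_natCast (Ideal.Quotient.mk Q)]
        exact Ideal.Quotient.eq_zero_iff_mem.2 hpQ
      exact CharP.ringChar_of_prime_eq_zero hp h0 ▸ ringChar.charP _
    have : Finite (𝓞 K ⧸ Q) := Ideal.finiteQuotientOfFreeOfNeBot Q hQ0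
    let _ : Algebra (ZMod p) (𝓞 K ⧸ Q) := ZMod.algebra _ p
    let _ : Algebra (ZMod p) Ω := ZMod.algebra _ p
    let e : {φ : 𝓞 K →+* Ω // RingHom.ker φ = Q} ≃ (𝓞 K ⧸ Q →ₐ[ZMod p] Ω) :=
      { toFun := fun φ =>
          { Ideal.Quotient.lift Q φ.1 (fun a ha => by rwa [← RingHom.mem_ker, φ.2]) with
            commutes' := fun r => by
              exact RingHom.congr_fun (Subsingleton.elim ((Ideal.Quotient.lift Q φ.1
                (fun a ha => by rwa [← RingHom.mem_ker, φ.2])).comp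
                (algebraMap (ZMod p) (𝓞 K ⧸ Q))) (algebraMap (ZMod p) Ω)) r }
        invFun := fun ψ => ⟨(ψ : 𝓞 K ⧸ Q →+* Ω).comp (Ideal.Quotient.mk Q), by
          rw [RingHom.ker_comp_of_injective _ (ψ : 𝓞 K ⧸ Q →+* Ω).injective, Ideal.mk_ker]⟩
        left_inv := fun φ => by ext; rfl
        right_inv := fun ψ => by ext x; obtain ⟨x, rfl⟩ := Ideal.Quotient.mk_surjective x; rfl }
    refine ⟨Finite.of_equiv _ e.symm, ?_⟩
    rw [Nat.card_congr e, Nat.card_eq_fintype_card, AlgHom.card, Ideal.absNorm_apply,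
      Submodule.cardQuot_apply, Module.natCard_eq_pow_finrank (K := ZMod p), Nat.card_zmod,
      hp.factorization_pow, Finsupp.single_eq_same]
  let f : (𝓞 K →+* Ω) → S := fun φ => ⟨RingHom.ker φ, hker φ⟩
  have hfib' : ∀ Q : S, Finite {φ // f φ = Q} ∧
      Nat.card {φ // f φ = Q} = (Ideal.absNorm (Q : Ideal (𝓞 K))).factorization p := by
    intro Q
    have h : ∀ φ, f φ = Q ↔ RingHom.ker φ = (Q : Ideal (𝓞 K)) := fun φ => Subtype.ext_iff
    simp only [h]
    exact hfib Q.1 Q.2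
  have := fun Q => (hfib' Q).1
  refine ⟨Finite.of_equiv _ (Equiv.sigmaFiberEquiv f), ?_⟩
  rw [← Nat.card_congr (Equiv.sigmaFiberEquiv f), Nat.card_sigma,
    ← Finset.sum_coe_sort S]
  exact Finset.sum_congr rfl fun Q _ => (hfib' Q).2

end

/-- The linear form with coefficients `a` in independent variables. -/
noncomputable def MvPolynomial.linearForm {ι R : Type*} [Fintype ι] [CommRing R] (a : ι → R) :
    MvPolynomial ι R :=
  ∑ i, MvPolynomial.C (a i) * MvPolynomial.X i

theorem MvPolynomial.map_linearForm {ι R S : Type*} [Fintype ι] [CommRing R] [CommRing S]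
    (f : R →+* S) (a : ι → R) :
    MvPolynomial.map f (linearForm a) = linearForm (fun i => f (a i)) := by
  simp [linearForm]

theorem MvPolynomial.linearForm_injective {ι R : Type*} [Fintype ι] [CommRing R] :
    Function.Injective (linearForm : (ι → R) → MvPolynomial ι R) := by
  intro a b h
  ext i
  have := congrArg (MvPolynomial.eval (Pi.single i 1)) h
  simpa [linearForm, Pi.single_apply] using this

theorem MvPolynomial.map_comp_map {ι R S T : Type*} [CommRing R] [CommRing S] [CommRing T]
    (f : R →+* S) (g : S →+* T) :
    (MvPolynomial.map g).comp (MvPolynomial.map (σ := ι) f) = MvPolynomial.map (g.comp f) :=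
  RingHom.ext fun x => MvPolynomial.map_map f g x

section

open NumberField

variable {K L : Type*} [Field K] [NumberField K] [Field L] [NumberField L]

theorem NumberField.exists_intCast_eq_of_forall_mapRingHom_eq [IsGalois ℚ L] (x : 𝓞 L)
    (hx : ∀ g : Gal(L/ℚ), RingOfIntegers.mapRingHom (g : L →+* L) x = x) :
    ∃ m : ℤ, (m : 𝓞 L) = x := by
  have hfix : (x : L) ∈ (⊥ : IntermediateField ℚ L) := by
    rw [IsGalois.mem_bot_iff_fixed]
    exact fun g => congrArg (algebraMap (𝓞 L) L) (hx g)
  obtain ⟨q, hq⟩ := IntermediateField.mem_bot.1 hfix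
  have hxint : IsIntegral ℤ q := by
    rw [← isIntegral_algebraMap_iff (algebraMap ℚ L).injective, hq]
    exact x.isIntegral_coe
  obtain ⟨m, hm⟩ := IsIntegrallyClosed.isIntegral_iff.1 hxint
  refine ⟨m, RingOfIntegers.coe_injective ?_⟩
  have h : (algebraMap (𝓞 L) L) x = algebraMap ℚ L q := hq.symm
  rw [h, ← hm]
  simp

theorem NumberField.exists_eq_comp_mapRingHom [IsGalois ℚ L] {Ω : Type*} [CommRing Ω] [IsDomain Ω]
    (σ₀ : K →ₐ[ℚ] L) (π : 𝓞 L →+* Ω) (φ : 𝓞 K →+* Ω) :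
    ∃ σ : K →ₐ[ℚ] L, φ = π.comp (RingOfIntegers.mapRingHom (σ : K →+* L)) := by
  let ω := Module.Free.chooseBasis ℤ (𝓞 K)
  let s : (K →ₐ[ℚ] L) → 𝓞 K →+* 𝓞 L := fun σ => RingOfIntegers.mapRingHom (σ : K →+* L)
  let F : (MvPolynomial _ (𝓞 L))[X] :=
    ∏ σ : K →ₐ[ℚ] L, (X - C (MvPolynomial.linearForm fun i => s σ (ω i)))
  have hinv : ∀ g : Gal(L/ℚ),
      F.map (MvPolynomial.map (RingOfIntegers.mapRingHom (g : L →+* L))) = F := by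
    intro g
    have hbij : Function.Bijective fun σ : K →ₐ[ℚ] L => (g : L →ₐ[ℚ] L).comp σ :=
      ⟨fun σ τ h => AlgHom.ext fun x => g.injective (AlgHom.congr_fun h x), fun σ =>
        ⟨(g.symm : L →ₐ[ℚ] L).comp σ, by ext; simp⟩⟩
    rw [Polynomial.map_prod]
    refine Eq.trans (Finset.prod_congr rfl fun σ _ => ?_) (Function.Bijective.prod_comp hbij
      (fun σ : K →ₐ[ℚ] L => X - C (MvPolynomial.linearForm fun i => s σ (ω i))))
    rw [Polynomial.map_sub, map_X, map_C, MvPolynomial.map_linearForm]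
    rfl
  obtain ⟨F₀, hF₀⟩ : ∃ F₀ : (MvPolynomial _ ℤ)[X],
      F₀.map (MvPolynomial.map (Int.castRingHom (𝓞 L))) = F := by
    have : F ∈ Polynomial.lifts (MvPolynomial.map (Int.castRingHom (𝓞 L))) := by
      rw [Polynomial.lifts_iff_coeff_lifts]
      intro j
      have hc : ∀ m, ∃ z : ℤ, (z : 𝓞 L) = (F.coeff j).coeff m := fun m =>
        exists_intCast_eq_of_forall_mapRingHom_eq _ fun g => by
          conv_rhs => rw [← hinv g]
          rw [Polynomial.coeff_map, MvPolynomial.coeff_map]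
      rw [MvPolynomial.mem_range_map_iff_coeffs_subset]
      intro c hc'
      obtain ⟨m, -, rfl⟩ := MvPolynomial.mem_coeffs_iff.1 hc'
      exact hc m
    exact this
  let u := MvPolynomial.linearForm fun i => ω i
  have hu : (F₀.map (MvPolynomial.map (Int.castRingHom (𝓞 K)))).eval u = 0 := by
    have hinj : Function.Injective (s σ₀) := fun x y h =>
      RingOfIntegers.coe_injective (σ₀.injective (congrArg (algebraMap (𝓞 L) L) h))
    refine MvPolynomial.map_injective (s σ₀) hinj ?_
    rw [map_zero, ← Polynomial.eval_map_apply, Polynomial.map_map, MvPolynomial.map_comp_map,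
      RingHom.ext_int ((s σ₀).comp _) (Int.castRingHom (𝓞 L)), hF₀, MvPolynomial.map_linearForm,
      Polynomial.eval_prod]
    exact Finset.prod_eq_zero (Finset.mem_univ σ₀) (by simp)
  have hφ : (F.map (MvPolynomial.map π)).eval (MvPolynomial.linearForm fun i => φ (ω i)) = 0 := by
    have := congrArg (MvPolynomial.map φ) hu
    rw [map_zero, ← Polynomial.eval_map_apply, Polynomial.map_map, MvPolynomial.map_comp_map,
      MvPolynomial.map_linearForm] at this
    rw [← hF₀, Polynomial.map_map, MvPolynomial.map_comp_map, ← this]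
    congr 3
    exact RingHom.ext_int _ _
  rw [Polynomial.map_prod, Polynomial.eval_prod, Finset.prod_eq_zero_iff] at hφ
  obtain ⟨σ, -, hσ⟩ := hφ
  rw [Polynomial.map_sub, map_X, map_C, eval_sub, eval_X, eval_C, sub_eq_zero,
    MvPolynomial.map_linearForm] at hσ
  refine ⟨σ, ?_⟩
  have hlin : φ.toAddMonoidHom.toIntLinearMap =
      (π.comp (s σ)).toAddMonoidHom.toIntLinearMap :=
    ω.ext fun i => congrFun (MvPolynomial.linearForm_injective hσ) i
  exact RingHom.ext fun x => LinearMap.congr_fun hlin x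

end

/-- A simple extension generated by a separable element has a Galois closure whose automorphism
group acts on the embeddings of the extension the way the Galois group of the minimal polynomial
acts on its roots. -/
theorem Polynomial.Gal.exists_galois_closure {F K A : Type} [Field F] [Field K] [Algebra F K]
    [Field A] [Algebra F A] {x : K} {f : F[X]} (hf : minpoly F x = f)
    (hx : IntermediateField.adjoin F {x} = ⊤)
    (hxint : IsIntegral F x) (hsep : f.Separable)
    [hA : Fact ((f.map (algebraMap F A)).Splits)] :
    ∃ (L : Type) (_ : Field L) (_ : Algebra F L) (_ : FiniteDimensional F L) (_ : IsGalois F L)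
      (E : (K →ₐ[F] L) ≃ f.rootSet A)
      (ρ : Gal(L/F) →* Equiv.Perm (f.rootSet A)),
      Function.Injective ρ ∧ ρ.range = (Polynomial.Gal.galActionHom f A).range ∧
        ∀ (g : Gal(L/F)) (σ : K →ₐ[F] L), E ((g : L →ₐ[F] L).comp σ) = ρ g (E σ) := by
  subst hf

  have hmin : ∀ y ∈ ({x} : Set K), ((minpoly F y).map
      (algebraMap F (minpoly F x).SplittingField)).Splits := by
    rintro y rfl
    exact SplittingField.splits _
  have hex : ∀ r ∈ (minpoly F x).rootSet (minpoly F x).SplittingField,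
      ∃ σ : K →ₐ[F] (minpoly F x).SplittingField, σ x = r := by
    intro r hr
    refine IntermediateField.exists_algHom_of_adjoin_splits_of_aeval (S := {x})
      (fun s hs => ⟨?_, hmin s hs⟩) hx (mem_rootSet.1 hr).2
    rwa [Set.mem_singleton_iff.1 hs]
  have hroot : ∀ σ : K →ₐ[F] (minpoly F x).SplittingField,
      σ x ∈ (minpoly F x).rootSet (minpoly F x).SplittingField := by
    intro σ
    rw [mem_rootSet]
    exact ⟨hsep.ne_zero, by rw [aeval_algHom_apply, minpoly.aeval, map_zero]⟩
  let E₁ : (K →ₐ[F] (minpoly F x).SplittingField) ≃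
      (minpoly F x).rootSet (minpoly F x).SplittingField :=
    Equiv.ofBijective (fun σ => ⟨σ x, hroot σ⟩) ⟨fun σ τ h => by
      have h1 : (σ.comp (IntermediateField.topEquiv.toAlgHom)) =
          τ.comp (IntermediateField.topEquiv.toAlgHom) :=
        IntermediateField.algHom_ext_of_eq_adjoin _ hx.symm (by
          rintro y rfl
          exact congrArg Subtype.val h)
      exact AlgHom.ext fun y =>
        DFunLike.congr_fun h1 (⟨y, trivial⟩ : (⊤ : IntermediateField F K)), fun r =>
      (hex r r.2).imp fun σ h => Subtype.ext h⟩
  have hE₁ : ∀ σ, (E₁ σ : (minpoly F x).SplittingField) = σ x := fun σ => rfl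
  clear_value E₁
  generalize minpoly F x = f at *
  let ι : Gal(f.SplittingField/F) ≃* f.Gal := MulEquiv.refl _
  refine ⟨f.SplittingField, inferInstance, inferInstance, inferInstance,
    IsGalois.of_separable_splitting_field hsep,
    E₁.trans (Polynomial.Gal.rootsEquivRoots f A),
    (Polynomial.Gal.galActionHom f A).comp ι.toMonoidHom, ?_, ?_, ?_⟩
  · exact (Polynomial.Gal.galActionHom_injective f A).comp ι.injective
  · rw [MonoidHom.range_comp, MonoidHom.range_eq_top.2 ι.surjective, MonoidHom.range_eq_map]
  · intro g σ
    have h1 : E₁ ((g : f.SplittingField →ₐ[F] f.SplittingField).comp σ) = ι g • E₁ σ := by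
      apply Subtype.ext
      rw [hE₁]
      change g (σ _) = g (E₁ σ : f.SplittingField)
      rw [hE₁]
    rw [Equiv.trans_apply, h1]
    change _ = ι g • (Polynomial.Gal.rootsEquivRoots f A (E₁ σ))
    rw [Polynomial.Gal.smul_def, Equiv.symm_apply_apply]

theorem IntermediateField.adjoin_gen_eq_top (F : Type*) {E : Type*} [Field F] [Field E]
    [Algebra F E] (α : E) :
    IntermediateField.adjoin F {IntermediateField.AdjoinSimple.gen F α} = ⊤ := by
  rw [← IntermediateField.lift_inj, IntermediateField.lift_top,
    IntermediateField.lift_adjoin_simple, IntermediateField.AdjoinSimple.coe_gen]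

/-- A field with Galois group `G` has a Galois closure whose automorphism group acts on the
embeddings of the field the way `G` acts on `Ω`. -/
theorem FieldHasGaloisGroup.exists_galois_closure {Ω : Type*} {G : Subgroup (Equiv.Perm Ω)}
    {K : IntermediateField ℚ ℂ} [NumberField K] (hK : FieldHasGaloisGroup G K) :
    ∃ (L : Type) (_ : Field L) (_ : NumberField L) (_ : IsGalois ℚ L)
      (E : (K →ₐ[ℚ] L) ≃ Ω) (ρ : Gal(L/ℚ) →* Equiv.Perm Ω),
      Function.Injective ρ ∧ ρ.range = G ∧
        ∀ (g : Gal(L/ℚ)) (σ : K →ₐ[ℚ] L), E ((g : L →ₐ[ℚ] L).comp σ) = ρ g (E σ) := by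
  obtain ⟨α, rfl, e, he⟩ := hK
  have hα : IsIntegral ℚ α :=
    (Algebra.IsIntegral.isIntegral (IntermediateField.AdjoinSimple.gen ℚ α)).map
      (IntermediateField.val _)
  have hfact : Fact (((minpoly ℚ α).map (algebraMap ℚ ℂ)).Splits) := ⟨IsAlgClosed.splits _⟩
  have key := Polynomial.Gal.exists_galois_closure (A := ℂ) (IntermediateField.minpoly_gen ℚ α)
    (IntermediateField.adjoin_gen_eq_top ℚ α)
    ((IntermediateField.AdjoinSimple.isIntegral_gen ℚ α).2 hα)
    (minpoly.irreducible hα).separable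
  rw [show IntermediateField.algebra' _ =
    (DivisionRing.toRatAlgebra : Algebra ℚ (IntermediateField.adjoin ℚ {α})) from
      Subsingleton.elim _ _] at key
  obtain ⟨L, _, inst, _, _, E, ρ, h1, h2, h3⟩ := key
  have hc : CharZero L := algebraRat.charZero L
  obtain rfl : inst = DivisionRing.toRatAlgebra := Subsingleton.elim _ _
  refine ⟨L, _, ⟨⟩, inferInstance, E.trans e, (permCongrHom e).comp ρ, ?_, ?_, ?_⟩
  · exact e.permCongr.injective.comp h1
  · rw [MonoidHom.range_comp, h2, ← he]
    rfl
  · intro g σ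
    simp [permCongrHom, Equiv.permCongr_apply, h3]

section

open NumberField UniqueFactorizationMonoid

variable (K L : Type) [Field K] [NumberField K] [Field L] [NumberField L]
variable {p : ℕ} [Fact p.Prime] {Ω : Type} [Field Ω] [IsAlgClosed Ω] [CharP Ω p]

theorem NumberField.nonempty_ringHom (p : ℕ) [Fact p.Prime] (Ω : Type) [Field Ω] [IsAlgClosed Ω]
    [CharP Ω p] : Nonempty (𝓞 K →+* Ω) := by
  have h := (NumberField.finite_ringHom_and_card_eq K p Ω)
  have h0 := (NumberField.factorization_discr_bounds K p).2.2.2.2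
  rw [← h.2] at h0
  exact (Nat.card_pos_iff.1 h0).1

variable {L} in
/-- A ramified prime has a nontrivial inertia element. -/
theorem NumberField.exists_ne_one_comp_mapRingHom_eq [IsGalois ℚ L] (π : 𝓞 L →+* Ω)
    (hp : (discr L).natAbs.factorization p ≠ 0) :
    ∃ g : Gal(L/ℚ), g ≠ 1 ∧ π.comp (RingOfIntegers.mapRingHom (g : L →+* L)) = π := by
  have h := (NumberField.finite_ringHom_and_card_eq L p Ω)
  have h0 := (NumberField.factorization_discr_bounds L p).2.2.2.1 hp
  have := h.1
  rw [← h.2, ← IsGalois.card_aut_eq_finrank] at h0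
  let F : Gal(L/ℚ) → (𝓞 L →+* Ω) := fun g => π.comp (RingOfIntegers.mapRingHom (g : L →+* L))
  have hF : ¬ Function.Injective F := fun hF => absurd (Nat.card_le_card_of_injective F hF) (by lia)
  simp only [Function.Injective, not_forall] at hF
  obtain ⟨g, h, hgh, hne⟩ := hF
  refine ⟨g * h⁻¹, fun h1 => hne (mul_inv_eq_one.1 h1), RingHom.ext fun x => ?_⟩
  have := RingHom.congr_fun hgh (RingOfIntegers.mapRingHom ((h⁻¹ : Gal(L/ℚ)) : L →+* L) x)
  have h2 : RingOfIntegers.mapRingHom (h : L →+* L)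
    (RingOfIntegers.mapRingHom ((h⁻¹ : Gal(L/ℚ)) : L →+* L) x) = x := by
    apply RingOfIntegers.ext
    change h (h⁻¹ (x : L)) = x
    exact h.apply_symm_apply _
  simp only [F, RingHom.comp_apply, h2] at this
  exact this

variable {K L}
variable {n : ℕ} {G : Subgroup (Equiv.Perm (Fin n))}
  (E : (K →ₐ[ℚ] L) ≃ Fin n) {ρ : Gal(L/ℚ) →* Equiv.Perm (Fin n)}

/-- The homomorphisms to `Ω` are obtained from the embeddings by reducing. -/
theorem NumberField.surjective_comp_mapRingHom [IsGalois ℚ L]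
    {Ω : Type*} [CommRing Ω] [IsDomain Ω] (hn : n ≠ 0) (π : 𝓞 L →+* Ω) :
    Function.Surjective fun i : Fin n =>
      π.comp (RingOfIntegers.mapRingHom (E.symm i : K →+* L)) := by
  intro φ
  obtain ⟨σ, rfl⟩ := NumberField.exists_eq_comp_mapRingHom (E.symm ⟨0, by lia⟩) π φ
  exact ⟨E σ, by simp⟩

theorem NumberField.groupIndex_le_factorization_discr [IsGalois ℚ L]
    (hn : n ≠ 0) (hfr : Module.finrank ℚ K = n)
    (hinj : Function.Injective ρ) (hρ : ρ.range = G)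
    (hE : ∀ (g : Gal(L/ℚ)) (σ : K →ₐ[ℚ] L), E ((g : L →ₐ[ℚ] L).comp σ) = ρ g (E σ))
    (hp : p ∈ (discr K).natAbs.primeFactors) :
    groupIndex G ≤ (discr K).natAbs.factorization p := by
  let Ω := AlgebraicClosure (ZMod p)
  obtain ⟨π⟩ := NumberField.nonempty_ringHom L p Ω
  have hdvd : discr K ∣ discr L := by
    let σ : K →+* L := E.symm ⟨0, by lia⟩
    let _ : Algebra K L := σ.toAlgebra
    exact NumberField.discr_dvd_discr K L
  have hpL : (discr L).natAbs.factorization p ≠ 0 := by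
    rw [← Finsupp.mem_support_iff, Nat.support_factorization, Nat.mem_primeFactors]
    refine ⟨Fact.out, (Nat.dvd_of_mem_primeFactors hp).trans (Int.natAbs_dvd_natAbs.2 hdvd), ?_⟩
    exact Int.natAbs_ne_zero.2 (discr_ne_zero L)
  obtain ⟨g, hg, hgπ⟩ := NumberField.exists_ne_one_comp_mapRingHom_eq π hpL
  have hcard : Nat.card (𝓞 K →+* Ω) ≤
      Nat.card (MulAction.orbitRel.Quotient (Subgroup.zpowers (ρ g)) (Fin n)) := by
    let F : Fin n → (𝓞 K →+* Ω) := fun i =>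
      π.comp (RingOfIntegers.mapRingHom (E.symm i : K →+* L))
    have hF1 : ∀ i, F (ρ g i) = F i := by
      intro i
      obtain ⟨σ, rfl⟩ := E.surjective i
      rw [← hE]
      simp only [F, Equiv.symm_apply_apply]
      conv_rhs => rw [← hgπ]
      rfl
    have hF2 : ∀ h ∈ Subgroup.zpowers (ρ g), ∀ i, F (h i) = F i := by
      intro h hh
      rw [Subgroup.zpowers_eq_closure] at hh
      induction hh using Subgroup.closure_induction with
      | mem a ha => rw [Set.mem_singleton_iff.1 ha]; exact hF1
      | one => simp
      | mul a b _ _ iha ihb => intro i; rw [Equiv.Perm.mul_apply, iha, ihb]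
      | inv a _ ih => intro i; rw [← ih, ← Equiv.Perm.mul_apply, mul_inv_cancel, Equiv.Perm.one_apply]
    let F' : MulAction.orbitRel.Quotient (Subgroup.zpowers (ρ g)) (Fin n) → (𝓞 K →+* Ω) :=
      Quotient.lift F (by
        rintro a b ⟨⟨h, hh⟩, rfl⟩
        exact hF2 h hh b)
    refine Nat.card_le_card_of_surjective F' fun φ => ?_
    obtain ⟨i, hi⟩ := NumberField.surjective_comp_mapRingHom E hn π φ
    exact ⟨Quotient.mk _ i, hi⟩
  have hb := (NumberField.factorization_discr_bounds K p).1
  rw [← (NumberField.finite_ringHom_and_card_eq K p Ω).2, hfr] at hb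
  have hle : groupIndex G ≤ permIndex (ρ g) := Nat.sInf_le
    ⟨ρ g, hρ ▸ ⟨g, rfl⟩, fun h => hg (hinj (h.trans ρ.map_one.symm)), rfl⟩
  rw [permIndex, Fintype.card_fin] at hle
  lia

/-- The number of distinct reductions of the conjugates of an integer is at most the degree minus
the exponent of a tamely ramified prime in the discriminant. -/
theorem NumberField.card_image_add_factorization_discr_le (hfr : Module.finrank ℚ K = n) (hp : n < p) (π : 𝓞 L →+* Ω) (b : 𝓞 K) :
    (Finset.univ.image fun i : Fin n =>
      π (RingOfIntegers.mapRingHom (E.symm i : K →+* L) b)).card +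
        (discr K).natAbs.factorization p ≤ n := by
  have hb := (NumberField.factorization_discr_bounds K p).2.1 (hfr ▸ hp)
  obtain ⟨_, h2⟩ := NumberField.finite_ringHom_and_card_eq K p Ω
  rw [← h2, hfr] at hb
  have := Fintype.ofFinite (𝓞 K →+* Ω)
  have h3 : (Finset.univ.image fun i : Fin n =>
      π (RingOfIntegers.mapRingHom (E.symm i : K →+* L) b)).card ≤ Nat.card (𝓞 K →+* Ω) := by
    rw [Nat.card_eq_fintype_card, ← Finset.card_univ]
    refine (Finset.card_le_card ?_).trans (Finset.card_image_le (f := fun φ : 𝓞 K →+* Ω => φ b))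
    intro y hy
    obtain ⟨i, -, rfl⟩ := Finset.mem_image.1 hy
    exact Finset.mem_image.2 ⟨π.comp (RingOfIntegers.mapRingHom (E.symm i : K →+* L)),
      Finset.mem_univ _, rfl⟩
  lia

end

section

open NumberField
open scoped Pointwise

variable {K L : Type} [Field K] [NumberField K] [Field L] {n : ℕ}

/-- The conjugates of an irrational element of a field with primitive Galois group are distinct. -/
theorem IsPrimitivePermGroup.injective_eval [NumberField L] [IsGalois ℚ L] {Ω : Type*}
    {G : Subgroup (Equiv.Perm Ω)}
    (hG : IsPrimitivePermGroup G) (E : (K →ₐ[ℚ] L) ≃ Ω) {ρ : Gal(L/ℚ) →* Equiv.Perm Ω}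
    (hρ : ρ.range = G)
    (hE : ∀ (g : Gal(L/ℚ)) (σ : K →ₐ[ℚ] L), E ((g : L →ₐ[ℚ] L).comp σ) = ρ g (E σ))
    {b : K} (hb : b ∉ (⊥ : IntermediateField ℚ K)) :
    Function.Injective fun i => E.symm i b := by
  have hE' : ∀ g i, E.symm (ρ g i) b = g (E.symm i b) := by
    intro g i
    obtain ⟨σ, rfl⟩ := E.surjective i
    rw [← hE]
    simp
  intro i j hij
  have hblock : MulAction.IsBlock G {j | E.symm j b = E.symm i b} := by
    rw [MulAction.isBlock_iff_smul_eq_or_disjoint]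
    rintro ⟨g, hg⟩
    obtain ⟨g, rfl⟩ : ∃ h, ρ h = g := by rwa [← hρ] at hg
    have hset : (⟨ρ g, hg⟩ : G) • {j | E.symm j b = E.symm i b} =
        {j | E.symm j b = g (E.symm i b)} := by
      ext j
      constructor
      · rintro ⟨j, hj, rfl⟩
        exact (hE' g j).trans (congrArg g hj)
      · intro hj
        refine ⟨ρ g⁻¹ j, ?_, ?_⟩
        · refine (hE' _ _).trans ?_
          rw [show E.symm j b = g (E.symm i b) from hj]
          exact g.symm_apply_apply _
        · change ρ g (ρ g⁻¹ j) = j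
          rw [← Equiv.Perm.mul_apply, ← map_mul, mul_inv_cancel, map_one, Equiv.Perm.one_apply]
    rw [hset]
    by_cases h : g (E.symm i b) = E.symm i b
    · left; rw [h]
    · right
      rw [Set.disjoint_left]
      intro j hj hj'
      exact h (hj.symm.trans hj')
  rcases hG.2 _ hblock with h | h
  · exact h rfl hij.symm
  · exfalso
    have hfix : E.symm i b ∈ (⊥ : IntermediateField ℚ L) := by
      rw [IsGalois.mem_bot_iff_fixed]
      intro g
      rw [← hE']
      exact (Set.eq_univ_iff_forall.1 h) (ρ g i)
    obtain ⟨q, hq⟩ := IntermediateField.mem_bot.1 hfix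
    refine hb (IntermediateField.mem_bot.2 ⟨q, (E.symm i).toRingHom.injective ?_⟩)
    exact ((E.symm i).commutes q).trans hq

theorem NumberField.natDegree_minpoly_int_le (b : 𝓞 K) :
    (minpoly ℤ b).natDegree ≤ Module.finrank ℚ K := by
  have hb : IsIntegral ℤ b := RingOfIntegers.isIntegral b
  rw [← (minpoly.monic hb).natDegree_map (algebraMap ℤ ℚ),
    ← minpoly.isIntegrallyClosed_eq_field_fractions ℚ K hb]
  exact minpoly.natDegree_le _

theorem NumberField.map_minpoly_int_eq_prod (hfr : Module.finrank ℚ K = n)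
    (σ : Fin n → (K →+* L)) (b : 𝓞 K) (hinj : Function.Injective fun i => σ i b) :
    (minpoly ℤ b).map (Int.castRingHom (𝓞 L)) =
      ∏ i, (X - C (RingOfIntegers.mapRingHom (σ i) b)) := by
  have hb : IsIntegral ℤ b := RingOfIntegers.isIntegral b
  have hmon := (minpoly.monic hb).map (Int.castRingHom (𝓞 L))
  have hinj' : Function.Injective fun i => RingOfIntegers.mapRingHom (σ i) b :=
    fun i j h => hinj (congrArg (algebraMap (𝓞 L) L) h)
  refine Polynomial.eq_of_monic_of_dvd_of_natDegree_le (monic_prod_X_sub_C _ _) hmon ?_ ?_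
  · have hle : (Finset.univ.image fun i => RingOfIntegers.mapRingHom (σ i) b).val ≤
        ((minpoly ℤ b).map (Int.castRingHom (𝓞 L))).roots := by
      rw [Multiset.le_iff_subset (Finset.nodup _)]
      intro x hx
      rw [Finset.mem_val] at hx
      obtain ⟨i, -, rfl⟩ := Finset.mem_image.1 hx
      rw [mem_roots hmon.ne_zero, IsRoot, eval_map]
      have := congrArg (RingOfIntegers.mapRingHom (σ i)) (minpoly.aeval ℤ b)
      rw [aeval_def, hom_eval₂, map_zero] at this
      rwa [Subsingleton.elim (Int.castRingHom (𝓞 L))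
        ((RingOfIntegers.mapRingHom (σ i)).comp (algebraMap ℤ (𝓞 K)))]
    have := (Multiset.prod_X_sub_C_dvd_iff_le_roots hmon.ne_zero _).2 hle
    convert this
    rw [Finset.image_val_of_injOn hinj'.injOn, Multiset.map_map]
    rfl
  · rw [natDegree_prod_of_monic _ _ fun i _ => monic_X_sub_C _,
      (minpoly.monic hb).natDegree_map]
    simpa [hfr] using natDegree_minpoly_int_le b

end

section

open NumberField

variable {K : Type*} [Field K] [NumberField K]

theorem NumberField.abs_coeff_minpoly_int_le {B : ℝ} {b : 𝓞 K} {n : ℕ}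
    (hdeg : (minpoly ℤ b).natDegree = n) (h : ∀ φ : K →+* ℂ, ‖φ b‖ ≤ B) {i : ℕ} (hi : i ≤ n) :
    |((minpoly ℤ b).coeff (n - i) : ℝ)| ≤ 2 ^ n * B ^ i := by
  have hb : IsIntegral ℤ b := RingOfIntegers.isIntegral b
  have hB : 0 ≤ B := (norm_nonneg _).trans (h (Classical.arbitrary _))
  have hroots : ∀ z ∈ ((minpoly ℤ b).map (Int.castRingHom ℂ)).roots, ‖z‖ ≤ B := by
    intro z hz
    have hz' : z ∈ (minpoly ℚ (b : K)).rootSet ℂ := by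
      rw [minpoly.isIntegrallyClosed_eq_field_fractions ℚ K hb, mem_rootSet]
      refine ⟨((minpoly.monic hb).map _).ne_zero, ?_⟩
      have := isRoot_of_mem_roots hz
      rw [IsRoot, eval_map] at this
      rw [aeval_map_algebraMap]
      exact this
    rw [← Embeddings.range_eval_eq_rootSet_minpoly K ℂ (b : K)] at hz'
    obtain ⟨φ, rfl⟩ := hz'
    exact h φ
  have h1 := coeff_le_of_roots_le (f := Int.castRingHom ℂ) (n - i) (minpoly.monic hb)
    (IsAlgClosed.splits _) hroots
  rw [hdeg, coeff_map, Nat.sub_sub_self hi, eq_intCast, Complex.norm_intCast, mul_comm] at h1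
  refine h1.trans ?_
  gcongr
  exact_mod_cast Nat.choose_le_two_pow _ _

theorem NumberField.coeff_minpoly_int_eq_zero {b : 𝓞 K} {n : ℕ} (hn : 0 < n)
    (hdeg : (minpoly ℤ b).natDegree = n) (h : Algebra.trace ℚ K b = 0) :
    (minpoly ℤ b).coeff (n - 1) = 0 := by
  have hb : IsIntegral ℤ b := RingOfIntegers.isIntegral b
  rw [trace_eq_finrank_mul_minpoly_nextCoeff,
    minpoly.isIntegrallyClosed_eq_field_fractions ℚ K hb, mul_eq_zero, neg_eq_zero,
    nextCoeff_map (algebraMap ℤ ℚ).injective_int,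
    nextCoeff_of_natDegree_pos (hdeg ▸ hn), hdeg] at h
  rcases h with h | h
  · exact absurd h (Nat.cast_ne_zero.2 Module.finrank_pos.ne')
  · simpa using h

theorem absDisc_eq (K : IntermediateField ℚ ℂ) [NumberField K] :
    absDisc K = (discr K).natAbs := by
  have h : FiniteDimensional ℚ K := inferInstance
  rw [absDisc, dif_pos h]

theorem IntermediateField.adjoin_eq_of_natDegree_minpoly_int (K : IntermediateField ℚ ℂ)
    [NumberField K] {b : 𝓞 K} (hb : (minpoly ℤ b).natDegree = Module.finrank ℚ K) :
    IntermediateField.adjoin ℚ {((b : K) : ℂ)} = K := by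
  have hbi : IsIntegral ℤ ((b : K) : ℂ) :=
    (RingOfIntegers.isIntegral_coe b).map (IsScalarTower.toAlgHom ℤ K ℂ)
  refine IntermediateField.eq_of_le_of_finrank_eq ?_ ?_
  · rw [IntermediateField.adjoin_simple_le_iff]
    exact (b : K).2
  · rw [IntermediateField.adjoin.finrank (hbi.tower_top),
      minpoly.isIntegrallyClosed_eq_field_fractions' ℚ hbi,
      (minpoly.monic hbi).natDegree_map]
    convert hb
    have h1 : minpoly ℤ ((b : K) : ℂ) = minpoly ℤ (b : K) :=
      minpoly.algebraMap_eq (algebraMap K ℂ).injective (b : K)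
    have h2 : minpoly ℤ (b : K) = minpoly ℤ b :=
      minpoly.algebraMap_eq RingOfIntegers.coe_injective b
    rw [h1, h2]

end

open NumberField in
/-- A field of degree `n` with primitive Galois group `G` is generated by a root of a polynomial
with small coefficients and few roots modulo the tamely ramified primes. -/
theorem FieldHasGaloisGroup.exists_polynomial {n : ℕ} (hn : 2 ≤ n)
    {G : Subgroup (Equiv.Perm (Fin n))} (hG : IsPrimitivePermGroup G) {K : IntermediateField ℚ ℂ}
    (hfr : Module.finrank ℚ K = n) (hK : FieldHasGaloisGroup G K) :
    0 < absDisc K ∧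
    (∀ p ∈ (absDisc K).primeFactors, groupIndex G ≤ (absDisc K).factorization p ∧
      (absDisc K).factorization p ≤ n * n) ∧
    ∃ f : ℤ[X], (f.Monic ∧ f.natDegree = n ∧ f.coeff (n - 1) = 0 ∧
      ∀ i ≤ n, |(f.coeff (n - i) : ℝ)| ≤
        (64 * n) ^ n * ((absDisc K : ℝ) ^ (1 / (2 * ((n : ℝ) - 1)))) ^ i) ∧
      (∃ z ∈ (f.map (Int.castRingHom ℂ)).roots, IntermediateField.adjoin ℚ {z} = K) ∧
      ∀ p ∈ (absDisc K).primeFactors, n < p → ∀ (F : Type) [Field F] [IsAlgClosed F] [CharP F p],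
        ∃ x : Fin n → F, f.map (Int.castRingHom F) = ∏ i, (X - C (x i)) ∧
          (Finset.univ.image x).card + (absDisc K).factorization p ≤ n := by
  have hfin : FiniteDimensional ℚ K := Module.finite_of_finrank_pos (by lia)
  have hNF : NumberField K := ⟨⟩
  have hfr' : Module.finrank ℚ K = n := hfr
  obtain ⟨L, _, _, _, E, ρ, hinj, hρ, hE⟩ := hK.exists_galois_closure
  rw [absDisc_eq]
  obtain ⟨b, hb, htr, hnorm⟩ := NumberField.exists_small_integer_trace_zero K (by lia)
  have hsep := hG.injective_eval E hρ hE hb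
  have hprod := NumberField.map_minpoly_int_eq_prod hfr' (fun i => (E.symm i : K →+* L)) b hsep
  have hbi : IsIntegral ℤ b := RingOfIntegers.isIntegral b
  have hdeg : (minpoly ℤ b).natDegree = n := by
    rw [← (minpoly.monic hbi).natDegree_map (Int.castRingHom (𝓞 L)), hprod,
      natDegree_prod_of_monic _ _ fun i _ => monic_X_sub_C _]
    simp
  refine ⟨Int.natAbs_pos.2 (discr_ne_zero K), fun p hp => ?_, minpoly ℤ b,
    ⟨minpoly.monic hbi, hdeg, coeff_minpoly_int_eq_zero (by lia) hdeg htr, fun i hi => ?_⟩,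
    ⟨(b : K), ?_, IntermediateField.adjoin_eq_of_natDegree_minpoly_int K (hdeg.trans hfr'.symm)⟩,
    fun p hp hnp F _ _ _ => ?_⟩
  · have : Fact p.Prime := ⟨Nat.prime_of_mem_primeFactors hp⟩
    refine ⟨groupIndex_le_factorization_discr E (by lia) hfr' hinj hρ hE hp, ?_⟩
    have := (NumberField.factorization_discr_bounds K p).2.2.1
    rwa [hfr'] at this
  · refine (abs_coeff_minpoly_int_le hdeg hnorm hi).trans ?_
    rw [hfr', mul_pow, ← mul_assoc]
    have h1 : (1 : ℝ) ≤ 32 * n := by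
      have : (2 : ℝ) ≤ n := by exact_mod_cast hn
      linarith
    calc _ ≤ (2 : ℝ) ^ n * (32 * n) ^ n * _ := by gcongr
      _ = _ := by rw [← mul_pow]; ring_nf
  · rw [mem_roots ((minpoly.monic hbi).map _).ne_zero, IsRoot, eval_map]
    have := congrArg ((algebraMap K ℂ).comp (algebraMap (𝓞 K) K)) (minpoly.aeval ℤ b)
    rw [aeval_def, hom_eval₂, map_zero] at this
    rwa [Subsingleton.elim (Int.castRingHom ℂ)
      (((algebraMap K ℂ).comp (algebraMap (𝓞 K) K)).comp (algebraMap ℤ (𝓞 K)))]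
  · have : Fact p.Prime := ⟨Nat.prime_of_mem_primeFactors hp⟩
    obtain ⟨π⟩ := NumberField.nonempty_ringHom L p F
    refine ⟨fun i => π (RingOfIntegers.mapRingHom (E.symm i : K →+* L) b), ?_,
      card_image_add_factorization_discr_le E hfr' hnp π b⟩
    have h1 := congrArg (Polynomial.map π) hprod
    rw [Polynomial.map_map, Polynomial.map_prod,
      Subsingleton.elim (π.comp (Int.castRingHom (𝓞 L))) (Int.castRingHom F)] at h1
    simpa using h1

theorem permIndex_pos {Ω : Type*} [Fintype Ω] {g : Equiv.Perm Ω} (hg : g ≠ 1) :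
    0 < permIndex g := by
  rw [permIndex, Nat.sub_pos_iff_lt, ← Nat.card_eq_fintype_card]
  let q : Ω → MulAction.orbitRel.Quotient (Subgroup.zpowers g) Ω := Quotient.mk _
  have hq : Function.Surjective q := Quotient.mk_surjective
  by_contra! hle
  have hinj : Function.Injective q := (hq.bijective_of_nat_card_le hle).1
  refine hg (Equiv.ext fun x => hinj (Quotient.sound ?_))
  exact ⟨⟨g, Subgroup.mem_zpowers g⟩, rfl⟩

theorem IsPrimitivePermGroup.groupIndex_pos {Ω : Type*} [Fintype Ω] [Nontrivial Ω]
    {G : Subgroup (Equiv.Perm Ω)} (hG : IsPrimitivePermGroup G) : 0 < groupIndex G := by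
  obtain ⟨x, y, hxy⟩ := exists_pair_ne Ω
  have := hG.1
  obtain ⟨⟨g, hg⟩, rfl⟩ := MulAction.exists_smul_eq G x y
  have hg1 : g ≠ 1 := by
    rintro rfl
    exact hxy rfl
  obtain ⟨h, -, h1, h2⟩ := Nat.sInf_mem (s := {k | ∃ g ∈ G, g ≠ 1 ∧ permIndex g = k})
    ⟨_, g, hg, hg1, rfl⟩
  rw [groupIndex, ← h2]
  exact permIndex_pos h1

/-- At most `n` fields are generated by a root of a given polynomial of degree `n`. -/
theorem IntermediateField.card_le_mul_card_image_of_roots {n : ℕ}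
    (S : Finset (IntermediateField ℚ ℂ)) (f : IntermediateField ℚ ℂ → ℤ[X])
    (hdeg : ∀ K ∈ S, (f K).natDegree = n)
    (hf : ∀ K ∈ S, ∃ z ∈ ((f K).map (Int.castRingHom ℂ)).roots,
      IntermediateField.adjoin ℚ {z} = K) :
    S.card ≤ n * (S.image f).card := by
  refine Finset.card_le_mul_card_image S n fun g hg => ?_
  obtain ⟨K₀, hK₀, rfl⟩ := Finset.mem_image.1 hg
  have hsub : S.filter (fun K => f K = f K₀) ⊆ ((f K₀).map (Int.castRingHom ℂ)).roots.toFinset.image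
      fun z => IntermediateField.adjoin ℚ {z} := by
    intro K hK
    obtain ⟨hK, hKe⟩ := Finset.mem_filter.1 hK
    obtain ⟨z, hz, rfl⟩ := hf K hK
    rw [hKe] at hz
    exact Finset.mem_image.2 ⟨z, Multiset.mem_toFinset.2 hz, rfl⟩
  calc _ ≤ _ := Finset.card_le_card hsub
    _ ≤ _ := Finset.card_image_le
    _ ≤ _ := Multiset.toFinset_card_le _
    _ ≤ _ := card_roots' _
    _ ≤ _ := natDegree_map_le
    _ = n := hdeg _ hK₀

/-- A bound independent of the index of the group. -/
theorem card_fields_le_of_isPrimitivePermGroup {n : ℕ} (hn : 2 ≤ n)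
    {G : Subgroup (Equiv.Perm (Fin n))} (hG : IsPrimitivePermGroup G) :
    ∃ C : ℝ, 1 ≤ C ∧ ∀ X : ℝ, 1 ≤ X → ∀ S : Finset (IntermediateField ℚ ℂ),
      (∀ K ∈ S, Module.finrank ℚ K = n ∧ FieldHasGaloisGroup G K ∧ (absDisc K : ℝ) ≤ X) →
      (S.card : ℝ) ≤ C * X ^ (((n : ℝ) + 2) / 4) := by
  have hn' : (2 : ℝ) ≤ n := by exact_mod_cast hn
  have hc : (1 : ℝ) ≤ (64 * n) ^ n := one_le_pow₀ (by linarith)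
  refine ⟨n * (3 * (64 * n) ^ n) ^ n,
    one_le_mul_of_one_le_of_one_le (by linarith) (one_le_pow₀ (by linarith)), fun X hX S hS => ?_⟩
  have hex := fun K (hK : K ∈ S) => (FieldHasGaloisGroup.exists_polynomial hn hG
    (hS K hK).1 (hS K hK).2.1).2.2
  choose! f hf using hex
  have h1 := IntermediateField.card_le_mul_card_image_of_roots S f
    (fun K hK => (hf K hK).1.2.1) (fun K hK => (hf K hK).2.1)
  have h2 := card_le_of_coeff_bounds hn hX hc rfl (S.image f) (by
    intro g hg
    obtain ⟨K, hK, rfl⟩ := Finset.mem_image.1 hg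
    obtain ⟨ha, hb, hc, hd⟩ := (hf K hK).1
    refine ⟨ha, hb, hc, fun i hi => (hd i hi).trans ?_⟩
    have := (hS K hK).2.2
    gcongr
    apply div_nonneg one_pos.le
    linarith)
  calc (S.card : ℝ) ≤ n * (S.image f).card := by exact_mod_cast h1
    _ ≤ n * ((3 * (64 * n) ^ n) ^ n * X ^ (((n : ℝ) + 2) / 4)) := by gcongr
    _ = _ := (mul_assoc _ _ _).symm

/-- The bound for groups of index at least two. -/
theorem card_fields_le_of_two_le_groupIndex {n : ℕ} (hn : 2 ≤ n)
    {G : Subgroup (Equiv.Perm (Fin n))} (hG : IsPrimitivePermGroup G) (hk : 2 ≤ groupIndex G)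
    {ε : ℝ} (hε : 0 < ε) :
    ∃ C : ℝ, 1 ≤ C ∧ ∀ X : ℝ, 1 ≤ X → ∀ S : Finset (IntermediateField ℚ ℂ),
      (∀ K ∈ S, Module.finrank ℚ K = n ∧ FieldHasGaloisGroup G K ∧ (absDisc K : ℝ) ≤ X) →
      (S.card : ℝ) ≤ C * X ^ (((n : ℝ) + 2) / 4 - 1 + 1 / (groupIndex G : ℝ) + ε) := by
  have hn' : (2 : ℝ) ≤ n := by exact_mod_cast hn
  have hc : (1 : ℝ) ≤ (64 * n) ^ n := one_le_pow₀ (by linarith)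
  obtain ⟨C₁, hC₁, h₁⟩ := exists_card_le_of_few_roots_mod_primes hn hk (n * n) hc (half_pos hε)
  obtain ⟨C₂, hC₂, h₂⟩ := exists_card_le_of_factorization_bounds (groupIndex G) (n * n)
    (by lia) (half_pos hε)
  refine ⟨n * C₁ * C₂, one_le_mul_of_one_le_of_one_le
    (one_le_mul_of_one_le_of_one_le (by linarith) hC₁) hC₂, fun X hX S hS => ?_⟩
  have hpoly := fun K (hK : K ∈ S) => FieldHasGaloisGroup.exists_polynomial hn hG
    (hS K hK).1 (hS K hK).2.1
  have hex := fun K (hK : K ∈ S) => (hpoly K hK).2.2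
  choose! f hf using hex
  have hfiber : ∀ D ∈ S.image absDisc, ((S.filter fun K => absDisc K = D).card : ℝ) ≤
      n * C₁ * X ^ (((n : ℝ) + 2) / 4 - 1 + ε / 2) := by
    intro D hD
    obtain ⟨K₀, hK₀, rfl⟩ := Finset.mem_image.1 hD
    obtain ⟨hpos, hfac, -⟩ := hpoly K₀ hK₀
    have hmem : ∀ K ∈ S.filter fun K => absDisc K = absDisc K₀, K ∈ S ∧ absDisc K = absDisc K₀ :=
      fun K hK => Finset.mem_filter.1 hK
    have h3 := IntermediateField.card_le_mul_card_image_of_roots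
      (S.filter fun K => absDisc K = absDisc K₀) f
      (fun K hK => (hf K (hmem K hK).1).1.2.1) (fun K hK => (hf K (hmem K hK).1).2.1)
    have h4 := h₁ (absDisc K₀) hpos hfac ((S.filter fun K => absDisc K = absDisc K₀).image f) (by
      intro g hg
      obtain ⟨K, hK, rfl⟩ := Finset.mem_image.1 hg
      obtain ⟨hKS, hKD⟩ := hmem K hK
      rw [← hKD]
      exact (hf K hKS).1) (by
      intro p hp hnp
      have : Fact p.Prime := ⟨Nat.prime_of_mem_primeFactors hp⟩
      refine ⟨AlgebraicClosure (ZMod p), inferInstance, inferInstance, fun g hg => ?_⟩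
      obtain ⟨K, hK, rfl⟩ := Finset.mem_image.1 hg
      obtain ⟨hKS, hKD⟩ := hmem K hK
      rw [← hKD] at hp ⊢
      exact (hf K hKS).2.2 p hp hnp _)
    have h5 : (absDisc K₀ : ℝ) ≤ X := (hS K₀ hK₀).2.2
    calc _ ≤ (n : ℝ) * ((S.filter fun K => absDisc K = absDisc K₀).image f).card := by
          exact_mod_cast h3
      _ ≤ n * (C₁ * X ^ (((n : ℝ) + 2) / 4 - 1 + ε / 2)) := by
          gcongr
          refine h4.trans ?_
          gcongr
          linarith
      _ = _ := by ring
  have h6 := h₂ X hX (S.image absDisc) (by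
    intro D hD
    obtain ⟨K, hK, rfl⟩ := Finset.mem_image.1 hD
    exact ⟨(hpoly K hK).1, (hS K hK).2.2, (hpoly K hK).2.1⟩)
  have h7 : S.card = ∑ D ∈ S.image absDisc, (S.filter fun K => absDisc K = D).card :=
    Finset.card_eq_sum_card_image absDisc S
  have hX0 : 0 < X := by linarith
  calc (S.card : ℝ) = ∑ D ∈ S.image absDisc, ((S.filter fun K => absDisc K = D).card : ℝ) := by
        rw [h7]; push_cast; rfl
    _ ≤ ((S.image absDisc).card : ℝ) * (n * C₁ * X ^ (((n : ℝ) + 2) / 4 - 1 + ε / 2)) := by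
        rw [← nsmul_eq_mul]; exact Finset.sum_le_card_nsmul _ _ _ hfiber
    _ ≤ C₂ * X ^ (1 / (groupIndex G : ℝ) + ε / 2) *
          (n * C₁ * X ^ (((n : ℝ) + 2) / 4 - 1 + ε / 2)) := by gcongr
    _ = n * C₁ * C₂ * (X ^ (1 / (groupIndex G : ℝ) + ε / 2) *
          X ^ (((n : ℝ) + 2) / 4 - 1 + ε / 2)) := by ring
    _ = _ := by rw [← Real.rpow_add hX0]; congr 2; ring

/-- Theorem 3.2 of Bhargava's paper. Let `G ≤ S_n` (`n > 1`) be a primitive permutation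
group with `k = ind(G)`. Then for every `ε > 0`, the number of number fields `K ⊆ ℂ` of
degree `n` with associated Galois group permutation-isomorphic to `G` and
`|disc(K)| ≤ X` is `O_ε(X^{(n+2)/4 - 1 + 1/k + ε})`. -/
theorem primitive_field_count_bound (n : ℕ) (hn : 1 < n)
    (G : Subgroup (Equiv.Perm (Fin n))) (hprim : IsPrimitivePermGroup G)
    (k : ℕ) (hk : k = groupIndex G) :
    ∀ ε : ℝ, 0 < ε → ∃ C : ℝ, 0 < C ∧ ∀ X : ℝ, 2 ≤ X →
      (Set.ncard {K : IntermediateField ℚ ℂ | Module.finrank ℚ K = n ∧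
          FieldHasGaloisGroup G K ∧ (absDisc K : ℝ) ≤ X} : ℝ)
        ≤ C * X ^ (((n : ℝ) + 2) / 4 - 1 + 1 / (k : ℝ) + ε) := by
  intro ε hε
  subst hk
  have : Nontrivial (Fin n) := Fin.nontrivial_iff_two_le.2 hn
  have hpos := hprim.groupIndex_pos
  suffices h : ∃ C : ℝ, 1 ≤ C ∧ ∀ X : ℝ, 1 ≤ X → ∀ S : Finset (IntermediateField ℚ ℂ),
      (∀ K ∈ S, Module.finrank ℚ K = n ∧ FieldHasGaloisGroup G K ∧ (absDisc K : ℝ) ≤ X) →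
      (S.card : ℝ) ≤ C * X ^ (((n : ℝ) + 2) / 4 - 1 + 1 / (groupIndex G : ℝ) + ε) by
    obtain ⟨C, hC, h⟩ := h
    refine ⟨C, by linarith, fun X hX => ?_⟩
    rcases Set.finite_or_infinite {K : IntermediateField ℚ ℂ | Module.finrank ℚ K = n ∧
      FieldHasGaloisGroup G K ∧ (absDisc K : ℝ) ≤ X} with hfin | hinf
    · rw [Set.ncard_eq_toFinset_card _ hfin]
      exact h X (by linarith) _ fun K hK => hfin.mem_toFinset.1 hK
    · rw [hinf.ncard, Nat.cast_zero]
      positivity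
  rcases eq_or_lt_of_le (Nat.succ_le_of_lt hpos) with h1 | h2
  · obtain ⟨C, hC, h⟩ := card_fields_le_of_isPrimitivePermGroup hn hprim
    refine ⟨C, hC, fun X hX S hS => (h X hX S hS).trans ?_⟩
    rw [← h1]
    gcongr
    norm_num
    exact hε.le
  · exact card_fields_le_of_two_le_groupIndex hn hprim h2 hε
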